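/- For every K ≥ 1 there exists C > 0 depending only on K with the following property. Assume f : ℝ³ × ℝ × ℝ³ → ℝ is of class C² with f ≥ 1/K everywhere and with |f| and all partial derivatives of f up to order 2 bounded by K; u : ℝ³ → ℝ is C^∞ on B₁₀ with σ₂(D²u(x)) = f(x, u(x), Du(x)) and Δu(x) > 0 on B₁₀; and |u(x)| + |Du(x)| ≤ K on B₁₀. Then sup_{B₅} Δu ≤ C · sup_{B₁} Δu. -/

import Mathlib

open Metric MeasureTheory Real

noncomputable section

abbrev E3 : Type := EuclideanSpace ℝ (Fin 3)

/-- The `i`-th partial derivative of `u`. -/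
def pd (i : Fin 3) (u : E3 → ℝ) : E3 → ℝ :=
  fun x => fderiv ℝ u x (EuclideanSpace.single i 1)

/-- The gradient `Du` of `u` as a vector in `ℝ³`. -/
def grad (u : E3 → ℝ) (x : E3) : E3 :=
  (WithLp.equiv 2 (Fin 3 → ℝ)).symm (fun i => pd i u x)

/-- The Hessian matrix `D²u`. -/
def hess (u : E3 → ℝ) (x : E3) : Matrix (Fin 3) (Fin 3) ℝ :=
  Matrix.of fun i j => pd i (pd j u) x

/-- The Laplacian `Δu`. -/
def lap (u : E3 → ℝ) (x : E3) : ℝ := ∑ i, hess u x i i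

def sigma1 (A : Matrix (Fin 3) (Fin 3) ℝ) : ℝ := A.trace

def sigma2 (A : Matrix (Fin 3) (Fin 3) ℝ) : ℝ := (A.trace ^ 2 - (A * A).trace) / 2

def sigma3 (A : Matrix (Fin 3) (Fin 3) ℝ) : ℝ := A.det

/-- The matrix `σ₂^{ij}(x) = Δu(x) δ_{ij} - ∂_i∂_j u(x)`. -/
def sg (u : E3 → ℝ) (x : E3) : Matrix (Fin 3) (Fin 3) ℝ :=
  lap u x • (1 : Matrix (Fin 3) (Fin 3) ℝ) - hess u x

/-- `f_{u_p}`: the partial derivative of `f` in its `p`-th gradient variable,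
evaluated at `(x, u(x), Du(x))`. -/
def fp (f : E3 × ℝ × E3 → ℝ) (u : E3 → ℝ) (p : Fin 3) (x : E3) : ℝ :=
  fderiv ℝ f (x, u x, grad u x) (0, 0, EuclideanSpace.single p 1)

/-- The standing hypotheses: `f` is `C²`, bounded below by `1/K`, with `|f|` and all
derivatives up to order 2 bounded by `K`; `u` is smooth on `B₁₀`, solves
`σ₂(D²u) = f(x,u,Du)` with `Δu > 0` on `B₁₀`, and `|u| + |Du| ≤ K` on `B₁₀`. -/
def Hyp (K : ℝ) (f : E3 × ℝ × E3 → ℝ) (u : E3 → ℝ) : Prop :=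
  ContDiff ℝ 2 f ∧
  (∀ z, 1 / K ≤ f z) ∧
  (∀ z, ∀ k : ℕ, k ≤ 2 → ‖iteratedFDeriv ℝ k f z‖ ≤ K) ∧
  ContDiffOn ℝ (⊤ : ℕ∞) u (ball (0 : E3) 10) ∧
  (∀ x ∈ ball (0 : E3) 10, sigma2 (hess u x) = f (x, u x, grad u x)) ∧
  (∀ x ∈ ball (0 : E3) 10, 0 < lap u x) ∧
  (∀ x ∈ ball (0 : E3) 10, |u x| + ‖grad u x‖ ≤ K)

lemma jac_aux (s F t g W : ℝ) (hs : 0 < s) (hF : 0 < F) (hd : F ≤ 4/3*s)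
    (hD : 15*((2/5)*(s+F)*t - g)^2 ≤ (6*s^2-8*F*s+6*F^2)*W) :
    (2/5 + 7/6*(F/s))*t^2 - 60*g^2/(s*F) ≤ W := by
  obtain ⟨h, rfl⟩ : ∃ h, g = s*h := ⟨g/s, by field_simp⟩
  obtain ⟨d, rfl⟩ : ∃ d, F = s*d := ⟨F/s, by field_simp⟩
  have hd0 : 0 < d := pos_of_mul_pos_right hF hs.le
  have hd1 : d ≤ 4/3 := by nlinarith
  have hD0 : (10/3:ℝ) ≤ 6-8*d+6*d^2 := by nlinarith [sq_nonneg (d-2/3)]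
  have hD1 : 15*((2/5)*(1+d)*t - h)^2 ≤ (6-8*d+6*d^2)*W := by
    have : s^2*(15*((2/5)*(1+d)*t - h)^2) ≤ s^2*((6-8*d+6*d^2)*W) := by
      convert hD using 1 <;> ring
    exact le_of_mul_le_mul_left this (by positivity)
  have e4 : s*d/s = d := by field_simp
  have e5 : 60*(s*h)^2/(s*(s*d)) = 60*h^2/d := by field_simp
  rw [e4, e5]
  have : (6-8*d+6*d^2)*((2/5 + 7/6*d)*t^2 - 60*h^2/d) ≤ (6-8*d+6*d^2)*W := by
    refine le_trans ?_ hD1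
    obtain ⟨k, rfl⟩ : ∃ k, h = d*k := ⟨h/d, by field_simp⟩
    have e6 : 60*(d*k)^2/d = 60*d*k^2 := by field_simp
    rw [e6]
    have h1 : 0 ≤ d*(t^2 - 12*(1+d)*t*k + 200*k^2) := by
      apply mul_nonneg hd0.le
      nlinarith [sq_nonneg (t - 6*(1+d)*k), mul_nonneg (sub_nonneg.2 hd1) (sq_nonneg k), mul_nonneg (mul_nonneg hd0.le (sub_nonneg.2 hd1)) (sq_nonneg k)]
    have h2 : 0 ≤ d*(d*(4/3-d)*t^2) := by
      have := sub_nonneg.2 hd1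
      positivity
    have h3 : 0 ≤ d*((6-8*d+6*d^2) - 10/3)*k^2 := by
      have := sub_nonneg.2 hD0
      positivity
    have h4 : 0 ≤ (d*k)^2 := by positivity
    nlinarith
  exact le_of_mul_le_mul_left this (by linarith)

/-- Jacobi inequality, one direction. -/
lemma jac (K l1 l2 l3 a b c g : ℝ) (hK : 1 ≤ K) (hs : 0 < l1+l2+l3)
    (hf : 1/K ≤ l1*l2+l1*l3+l2*l3)
    (hg : (l2+l3)*a+(l1+l3)*b+(l1+l2)*c = g) :
    (7/6) * ((l2+l3)/(l1+l2+l3)) * (a+b+c)^2 - 60*K*g^2 ≤ a^2+3*b^2+3*c^2-(a+b+c)^2 := by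
  have hK0 : 0 < K := by linarith
  have hf0 : 0 < l1*l2+l1*l3+l2*l3 := lt_of_lt_of_le (by positivity) hf
  obtain ⟨s, rfl⟩ : ∃ s, l1 = s - l2 - l3 := ⟨l1+l2+l3, by ring⟩
  obtain ⟨F, rfl⟩ : ∃ F, l2 = F - l3 := ⟨l2+l3, by ring⟩
  have e1 : s - (F - l3) - l3 + (F - l3) + l3 = s := by ring
  have e2 : F - l3 + l3 = F := by ring
  rw [e1] at hs ⊢
  rw [e2] at hg ⊢
  obtain ⟨t, rfl⟩ : ∃ t, a = t - b - c := ⟨a+b+c, by ring⟩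
  have e3 : t - b - c + b + c = t := by ring
  rw [e3]
  set f := (s - (F - l3) - l3) * (F - l3) + (s - (F - l3) - l3) * l3 + (F - l3) * l3 with hfd
  have hF : 0 < F := by
    by_contra h
    push Not at h
    nlinarith [sq_nonneg (F-l3), sq_nonneg l3, sq_nonneg (F - 2*l3), mul_nonneg hs.le (neg_nonneg.2 h)]
  have hsF : f ≤ s*F := by nlinarith [sq_nonneg (F-l3), sq_nonneg l3]
  have hd : F ≤ 4/3*s := by
    have : 0 < F*(4*s-3*F) := by nlinarith [sq_nonneg (F-2*l3)]
    have := pos_of_mul_pos_right this hF.le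
    linarith
  set W := (t-b-c)^2+3*b^2+3*c^2 - 3/5*t^2 with hW
  have hD : 15*((2/5)*(s+F)*t - g)^2 ≤ (6*s^2-8*F*s+6*F^2)*W := by
    have hW0 : 0 ≤ W := by nlinarith [sq_nonneg (b-t/5), sq_nonneg (c-t/5), sq_nonneg (b-t/5+(c-t/5))]
    have key : 15*((2/5)*(s+F)*t - g)^2 + 10*f*W + ((b-t/5)*(4*((s - (F - l3) - l3)-l3)-((s - (F - l3) - l3)-(F-l3))) - (c-t/5)*(4*((s - (F - l3) - l3)-(F-l3))-((s - (F - l3) - l3)-l3)))^2 = (6*s^2-8*F*s+6*F^2)*W := by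
      rw [← hg, hW, hfd]; ring
    nlinarith [mul_nonneg hf0.le hW0, sq_nonneg ((b-t/5)*(4*((s - (F - l3) - l3)-l3)-((s - (F - l3) - l3)-(F-l3))) - (c-t/5)*(4*((s - (F - l3) - l3)-(F-l3))-((s - (F - l3) - l3)-l3)))]
  -- normalise
  have main : (2/5 + 7/6*(F/s))*t^2 - 60*g^2/(s*F) ≤ W := jac_aux s F t g W hs hF hd hD
  have h6 : 60*g^2/(s*F) ≤ 60*K*g^2 := by
    rw [div_le_iff₀ (by positivity)]
    have : 1 ≤ K*(s*F) := by
      have : 1/K ≤ s*F := hf.trans hsF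
      rw [div_le_iff₀ hK0] at this; linarith
    nlinarith [sq_nonneg g]
  nlinarith

/-! ### Calculus toolkit -/

abbrev ee (k : Fin 3) : E3 := EuclideanSpace.single k 1

lemma pd_congr {h g : E3 → ℝ} {x : E3} (k : Fin 3) (H : h =ᶠ[nhds x] g) : pd k h x = pd k g x := by
  simp only [pd, H.fderiv_eq]

lemma pd_congr' {h g : E3 → ℝ} {x : E3} (k : Fin 3) (H : h =ᶠ[nhds x] g) :
    pd k h =ᶠ[nhds x] pd k g := by
  filter_upwards [H.eventuallyEq_nhds] with y hy using pd_congr k hy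

lemma pd_contDiffAt {h : E3 → ℝ} {x : E3} {m n : WithTop ℕ∞} (k : Fin 3) (hh : ContDiffAt ℝ n h x)
    (hmn : m + 1 ≤ n) : ContDiffAt ℝ m (pd k h) x := by
  unfold pd
  exact (hh.fderiv_right hmn).clm_apply contDiffAt_const

lemma pd_smooth {h : E3 → ℝ} {x : E3} (k : Fin 3) (hh : ContDiffAt ℝ (⊤ : ℕ∞) h x) :
    ContDiffAt ℝ (⊤ : ℕ∞) (pd k h) x := pd_contDiffAt k hh (by norm_num)

lemma cd2_ev {h : E3 → ℝ} {x : E3} (hh : ContDiffAt ℝ 2 h x) :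
    ∀ᶠ y in nhds x, DifferentiableAt ℝ h y := by
  filter_upwards [hh.eventually (by decide)] with y hy
  exact hy.differentiableAt (by norm_num)

lemma pd_diff {h : E3 → ℝ} {x : E3} (k : Fin 3) (hh : ContDiffAt ℝ 2 h x) :
    DifferentiableAt ℝ (pd k h) x :=
  (pd_contDiffAt (m := 1) k hh (by norm_num [one_add_one_eq_two])).differentiableAt (by norm_num)

lemma pd_pd {h : E3 → ℝ} {x : E3} (i j : Fin 3) (hh : ContDiffAt ℝ 2 h x) :
    pd i (pd j h) x = fderiv ℝ (fderiv ℝ h) x (ee i) (ee j) := by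
  have h1 : DifferentiableAt ℝ (fderiv ℝ h) x :=
    (hh.fderiv_right (m := 1) (by norm_num [one_add_one_eq_two])).differentiableAt (by norm_num)
  have : pd i (pd j h) x = fderiv ℝ (fun y => fderiv ℝ h y (ee j)) x (ee i) := rfl
  rw [this, fderiv_clm_apply h1 (differentiableAt_const _)]
  simp

lemma pd_comm {h : E3 → ℝ} {x : E3} (i j : Fin 3) (hh : ContDiffAt ℝ 2 h x) :
    pd i (pd j h) x = pd j (pd i h) x := by
  rw [pd_pd i j hh, pd_pd j i hh]
  exact hh.isSymmSndFDerivAt (by simp) _ _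

lemma pd_add {h g : E3 → ℝ} {x : E3} (k : Fin 3) (hh : DifferentiableAt ℝ h x)
    (hg : DifferentiableAt ℝ g x) : pd k (fun y => h y + g y) x = pd k h x + pd k g x := by
  simp only [pd, fderiv_fun_add hh hg, add_apply]

lemma pd_mul {h g : E3 → ℝ} {x : E3} (k : Fin 3) (hh : DifferentiableAt ℝ h x)
    (hg : DifferentiableAt ℝ g x) :
    pd k (fun y => h y * g y) x = pd k h x * g x + h x * pd k g x := by
  simp only [pd, fderiv_fun_mul hh hg, add_apply,
    smul_apply, smul_eq_mul]
  ring

lemma pd_const (k : Fin 3) (c : ℝ) (x : E3) : pd k (fun _ => c) x = 0 := by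
  simp [pd]

/-- second order jet of `h` at `x` in direction `k`. -/
structure Jet (k : Fin 3) (h : E3 → ℝ) (x : E3) (a c : ℝ) : Prop where
  cd : ContDiffAt ℝ 2 h x
  d1 : pd k h x = a
  d2 : pd k (pd k h) x = c

lemma Jet.of {h : E3 → ℝ} {x : E3} (k : Fin 3) (hh : ContDiffAt ℝ 2 h x) :
    Jet k h x (pd k h x) (pd k (pd k h) x) := ⟨hh, rfl, rfl⟩

lemma Jet.add {k : Fin 3} {h g : E3 → ℝ} {x : E3} {a c a' c' : ℝ} (H : Jet k h x a c)
    (G : Jet k g x a' c') : Jet k (fun y => h y + g y) x (a + a') (c + c') := by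
  refine ⟨H.cd.add G.cd, ?_, ?_⟩
  · rw [pd_add k (H.cd.differentiableAt (by norm_num)) (G.cd.differentiableAt (by norm_num)), H.d1, G.d1]
  · have : pd k (fun y => h y + g y) =ᶠ[nhds x] fun y => pd k h y + pd k g y := by
      filter_upwards [cd2_ev H.cd, cd2_ev G.cd] with y h1 h2 using pd_add k h1 h2
    rw [pd_congr k this, pd_add k (pd_diff k H.cd) (pd_diff k G.cd), H.d2, G.d2]

lemma Jet.const (k : Fin 3) (x : E3) (r : ℝ) : Jet k (fun _ => r) x 0 0 := by
  refine ⟨contDiffAt_const, pd_const k r x, ?_⟩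
  have : pd k (fun _ : E3 => r) = fun _ => 0 := by
    funext y; exact pd_const k r y
  rw [this, pd_const]

lemma Jet.mul {k : Fin 3} {h g : E3 → ℝ} {x : E3} {a c a' c' : ℝ} (H : Jet k h x a c)
    (G : Jet k g x a' c') :
    Jet k (fun y => h y * g y) x (a * g x + h x * a') (c * g x + 2 * a * a' + h x * c') := by
  refine ⟨H.cd.mul G.cd, ?_, ?_⟩
  · rw [pd_mul k (H.cd.differentiableAt (by norm_num)) (G.cd.differentiableAt (by norm_num)), H.d1, G.d1]
  · have : pd k (fun y => h y * g y) =ᶠ[nhds x] fun y => pd k h y * g y + h y * pd k g y := by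
      filter_upwards [cd2_ev H.cd, cd2_ev G.cd] with y h1 h2 using pd_mul k h1 h2
    have dh := H.cd.differentiableAt (by norm_num)
    have dg := G.cd.differentiableAt (by norm_num)
    rw [pd_congr k this, pd_add k ((pd_diff k H.cd).fun_mul dg) (dh.fun_mul (pd_diff k G.cd)),
      pd_mul k (pd_diff k H.cd) dg, pd_mul k dh (pd_diff k G.cd), H.d2, G.d2, H.d1, G.d1]
    ring

lemma Jet.cmul {k : Fin 3} {h : E3 → ℝ} {x : E3} {a c : ℝ} (r : ℝ) (H : Jet k h x a c) :
    Jet k (fun y => r * h y) x (r * a) (r * c) := by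
  have := (Jet.const k x r).mul H
  simpa using this

lemma pd_log {h : E3 → ℝ} {x : E3} (k : Fin 3) (hh : DifferentiableAt ℝ h x) (h0 : h x ≠ 0) :
    pd k (fun y => Real.log (h y)) x = (h x)⁻¹ * pd k h x := by
  simp only [pd, fderiv.log hh h0, smul_apply, smul_eq_mul]

lemma Jet.log {k : Fin 3} {h : E3 → ℝ} {x : E3} {a c : ℝ} (H : Jet k h x a c) (h0 : h x ≠ 0) :
    Jet k (fun y => Real.log (h y)) x (a / h x) (c / h x - a ^ 2 / h x ^ 2) := by
  have dh := H.cd.differentiableAt (by norm_num)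
  refine ⟨H.cd.log h0, ?_, ?_⟩
  · rw [pd_log k dh h0, H.d1]; ring
  · have he : ∀ᶠ y in nhds x, h y ≠ 0 := H.cd.continuousAt.eventually_ne h0
    have e1 : pd k (fun y => Real.log (h y)) =ᶠ[nhds x] fun y => (h y)⁻¹ * pd k h y := by
      filter_upwards [cd2_ev H.cd, he] with y h1 h2 using pd_log k h1 h2
    have e2 : pd k (fun y => (h y)⁻¹) x = - (h x ^ 2)⁻¹ * pd k h x := by
      have := (hasDerivAt_inv h0).comp_hasFDerivAt x dh.hasFDerivAt
      have t2 : fderiv ℝ (fun y => (h y)⁻¹) x = _ := this.fderiv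
      simp only [pd, t2, smul_apply, smul_eq_mul]
    rw [pd_congr k e1, pd_mul k (dh.fun_inv h0) (pd_diff k H.cd), e2, H.d2, H.d1]
    field_simp
    ring

lemma Jet.congr {k : Fin 3} {h g : E3 → ℝ} {x : E3} {a c : ℝ} (H : Jet k h x a c)
    (e : g =ᶠ[nhds x] h) : Jet k g x a c :=
  ⟨H.cd.congr_of_eventuallyEq e, (pd_congr k e).trans H.d1, (pd_congr k (pd_congr' k e)).trans H.d2⟩

lemma Jet.vals {k : Fin 3} {h : E3 → ℝ} {x : E3} {a c a' c' : ℝ} (H : Jet k h x a c)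
    (ha : a' = a) (hc : c' = c) : Jet k h x a' c' := by subst ha; subst hc; exact H

lemma pd_coord (k l : Fin 3) (x : E3) : pd k (fun y : E3 => y l) x = if l = k then 1 else 0 := by
  have : (fun y : E3 => y l) = (EuclideanSpace.proj l : E3 →L[ℝ] ℝ) := rfl
  rw [pd, this, ContinuousLinearMap.fderiv]
  simp

lemma Jet.coord (k l : Fin 3) (x : E3) : Jet k (fun y : E3 => y l) x (if l = k then 1 else 0) 0 := by
  refine ⟨?_, pd_coord k l x, ?_⟩
  · exact (EuclideanSpace.proj l : E3 →L[ℝ] ℝ).contDiff.contDiffAt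
  · have : pd k (fun y : E3 => y l) = fun _ => if l = k then 1 else 0 := by
      funext y; exact pd_coord k l y
    rw [this, pd_const]

/-- first and second order conditions at a local max. -/
lemma Jet.max {k : Fin 3} {h : E3 → ℝ} {x : E3} {a c : ℝ} (H : Jet k h x a c)
    (hm : IsLocalMax h x) : a = 0 ∧ c ≤ 0 := by
  have ha : a = 0 := by
    rw [← H.d1, pd, hm.fderiv_eq_zero]; rfl
  refine ⟨ha, ?_⟩
  by_contra hc
  push Not at hc
  let γ : ℝ → E3 := fun s => x + s • ee k
  have hγ : ∀ s, HasDerivAt γ (ee k) s := by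
    intro s
    have := ((hasDerivAt_id s).smul_const (ee k)).const_add x
    rw [one_smul] at this
    exact this
  have hγ0 : γ 0 = x := by simp [γ]
  have hγc : Filter.Tendsto γ (nhds 0) (nhds x) := by
    have := (hγ 0).continuousAt.tendsto; rwa [hγ0] at this
  have key : ∀ {g : E3 → ℝ} {s : ℝ}, DifferentiableAt ℝ g (γ s) →
      deriv (fun r => g (γ r)) s = pd k g (γ s) := by
    intro g s hg
    exact (hg.hasFDerivAt.comp_hasDerivAt s (hγ s)).deriv
  have e1 : deriv (fun r => h (γ r)) =ᶠ[nhds 0] fun s => pd k h (γ s) := by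
    filter_upwards [hγc.eventually (cd2_ev H.cd)] with s hs using key hs
  have d1 : deriv (fun r => h (γ r)) 0 = 0 := by
    rw [e1.eq_of_nhds, hγ0, H.d1, ha]
  have d2 : deriv (deriv (fun r => h (γ r))) 0 = c := by
    rw [e1.deriv_eq, key (by rw [hγ0]; exact pd_diff k H.cd), hγ0, H.d2]
  have cont : ContinuousAt (fun r => h (γ r)) 0 := by
    have : ContinuousAt h (γ 0) := by rw [hγ0]; exact H.cd.continuousAt
    exact this.comp (hγ 0).continuousAt
  have hmin := isLocalMin_of_deriv_deriv_pos (by rw [d2]; exact hc) d1 cont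
  have hmax : ∀ᶠ s in nhds (0:ℝ), h (γ s) ≤ h (γ 0) := by
    rw [hγ0]; exact hγc.eventually hm
  have hconst : (fun r => h (γ r)) =ᶠ[nhds 0] fun _ => h (γ 0) := by
    filter_upwards [hmin, hmax] with s h1 h2 using le_antisymm h2 h1
  have : deriv (fun r => h (γ r)) =ᶠ[nhds 0] fun _ => 0 := by
    have := hconst.deriv
    simpa using this
  have h3 := this.deriv_eq
  rw [d2] at h3
  simp at h3
  linarith

/-! ### Pointwise algebra -/

lemma lam_bds (K l1 l2 l3 : ℝ) (hK : 1 ≤ K) (hs : 0 < l1+l2+l3)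
    (hf : 1/K ≤ l1*l2+l1*l3+l2*l3) :
    |l1| ≤ l1+l2+l3 ∧ 1 ≤ K*(l1+l2+l3)*(l1+l2+l3-l1) ∧ 0 < l1+l2+l3-l1 ∧ 1 ≤ K*(l1+l2+l3) := by
  have hK0 : 0 < K := by linarith
  have hf0 : 0 < l1*l2+l1*l3+l2*l3 := lt_of_lt_of_le (by positivity) hf
  rw [div_le_iff₀ hK0] at hf
  have h1 : |l1| ≤ l1+l2+l3 := by
    apply abs_le_of_sq_le_sq _ hs.le
    nlinarith [sq_nonneg l2, sq_nonneg l3]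
  have h1' := le_of_abs_le h1
  have h2 : l1*l2+l1*l3+l2*l3 ≤ (l1+l2+l3)*(l1+l2+l3-l1) := by
    nlinarith [sq_nonneg l2, sq_nonneg l3, sq_nonneg (l2+l3)]
  refine ⟨h1, ?_, ?_, ?_⟩
  · nlinarith
  · by_contra h
    push Not at h
    nlinarith
  · have : 1 ≤ K * (l1+l2+l3)^2 := by
      nlinarith [sq_nonneg l1, sq_nonneg l2, sq_nonneg l3]
    by_contra h
    push Not at h
    have : K * (l1+l2+l3)^2 < 1 * (l1+l2+l3) := by nlinarith
    nlinarith

set_option maxHeartbeats 2000000 in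
lemma alg_core (K α β ρ b σ f Dφ : ℝ) (l t x p A B S φ : Fin 3 → ℝ)
    (T : Fin 3 → Fin 3 → Fin 3 → ℝ)
    (hK : 1 ≤ K) (hρ : 0 < ρ) (hb : 0 < b) (hα : 0 ≤ α)
    (hσ : σ = l 0 + l 1 + l 2) (hσ0 : 0 < σ)
    (hfd : f = l 0 * l 1 + l 0 * l 2 + l 1 * l 2) (hf : 1/K ≤ f)
    (hT1 : ∀ i j k, T i j k = T j i k) (hT2 : ∀ i j k, T i j k = T i k j)
    (ht : ∀ k, t k = T 0 0 k + T 1 1 k + T 2 2 k)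
    (hφ1 : ∀ k, (σ - l 0) * T 0 0 k + (σ - l 1) * T 1 1 k + (σ - l 2) * T 2 2 k = φ k)
    (hφA : ∀ k, φ k = A k + B k * l k) (hA : ∀ k, |A k| ≤ K^2) (hB : ∀ k, |B k| ≤ K)
    (hx : ∀ k, |x k| ≤ 8) (hc : ∀ k, |α * x k + β * p k| ≤ 1)
    (hφ2 : ((σ - l 0) * S 0 + (σ - l 1) * S 1 + (σ - l 2) * S 2) + (t 0 ^2 + t 1 ^2 + t 2 ^2)
      - (∑ i, ∑ j, ∑ k, T i j k ^2) = Dφ)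
    (hDφ : (B 0 * t 0 + B 1 * t 1 + B 2 * t 2) - 10*K^5*σ^2 ≤ Dφ)
    (h1st : ∀ k, -4 * x k / ρ + (α * x k + β * p k) * l k + t k / σ / b = 0)
    (h2nd : ∀ k, -4/ρ - 8 * x k^2/ρ^2 + (α * l k + β * l k^2 +
      ((α * x 0 + β * p 0) * T 0 k k + (α * x 1 + β * p 1) * T 1 k k
        + (α * x 2 + β * p 2) * T 2 k k)) +
      (S k / σ - t k^2/σ^2) / b - (t k / σ)^2/b^2 ≤ 0) :
    β * ((σ - l 0) * l 0^2 + (σ - l 1) * l 1^2 + (σ - l 2) * l 2^2)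
      + (1/6/b - 1/b^2) * ((σ - l 0) * (t 0/σ)^2 + (σ - l 1) * (t 1/σ)^2 + (σ - l 2) * (t 2/σ)^2)
    ≤ 8*σ/ρ + 8*((σ - l 0) * x 0^2 + (σ - l 1) * x 1^2 + (σ - l 2) * x 2^2)/ρ^2
      + 100*K/ρ + 3*K^2 + 730*K^7*σ/b := by
  have hK0 : 0 < K := by linarith
  have hf0 : 0 < f := lt_of_lt_of_le (by positivity) hf
  have L0 := lam_bds K (l 0) (l 1) (l 2) hK (by linarith) (by linarith)
  have L1 := lam_bds K (l 1) (l 0) (l 2) hK (by linarith) (by linarith)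
  have L2 := lam_bds K (l 2) (l 0) (l 1) hK (by linarith) (by linarith)
  rw [← hσ] at L0
  rw [show l 1 + l 0 + l 2 = σ by rw [hσ]; ring] at L1
  rw [show l 2 + l 0 + l 1 = σ by rw [hσ]; ring] at L2
  have hlσ : ∀ k, |l k| ≤ σ := by
    intro k; fin_cases k
    exacts [L0.1, L1.1, L2.1]
  have hKσ : 1 ≤ K * σ := L0.2.2.2
  -- bound on φ
  have hφb : ∀ k, φ k ^2 ≤ 4*K^6*σ^2 := by
    intro k
    have h1 : |φ k| ≤ 2*K^3*σ := by
      rw [hφA]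
      have e1 : |A k + B k * l k| ≤ K^2 + K*σ := by
        refine (abs_add_le _ _).trans (add_le_add (hA k) ?_)
        rw [abs_mul]
        exact mul_le_mul (hB k) (hlσ k) (abs_nonneg _) hK0.le
      have e2 : K^2 ≤ K^3*σ := by nlinarith [sq_nonneg K]
      have e3 : K*σ ≤ K^3*σ := by
        have : K ≤ K^3 := le_self_pow₀ hK (by norm_num)
        nlinarith
      linarith
    have := sq_le_sq' (by linarith [neg_abs_le (φ k)]) ((le_abs_self _).trans h1)
    calc _ ≤ _ := this
      _ = _ := by ring
  -- Jacobi
  have J0 := jac K (l 0) (l 1) (l 2) (T 0 0 0) (T 1 1 0) (T 2 2 0) (φ 0) hK (by linarith) (by linarith)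
    (by rw [← hφ1 0, hσ]; ring)
  have J1 := jac K (l 1) (l 0) (l 2) (T 1 1 1) (T 0 0 1) (T 2 2 1) (φ 1) hK (by linarith) (by linarith)
    (by rw [← hφ1 1, hσ]; ring)
  have J2 := jac K (l 2) (l 0) (l 1) (T 2 2 2) (T 0 0 2) (T 1 1 2) (φ 2) hK (by linarith) (by linarith)
    (by rw [← hφ1 2, hσ]; ring)
  rw [← hσ, show l 1 + l 2 = σ - l 0 by rw [hσ]; ring, show T 0 0 0 + T 1 1 0 + T 2 2 0 = t 0 from (ht 0).symm] at J0
  rw [show l 1 + l 0 + l 2 = σ by rw [hσ]; ring, show l 0 + l 2 = σ - l 1 by rw [hσ]; ring,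
    show T 1 1 1 + T 0 0 1 + T 2 2 1 = t 1 by rw [ht 1]; ring] at J1
  rw [show l 2 + l 0 + l 1 = σ by rw [hσ]; ring, show l 0 + l 1 = σ - l 2 by rw [hσ]; ring,
    show T 2 2 2 + T 0 0 2 + T 1 1 2 = t 2 by rw [ht 2]; ring] at J2
  have hTsum : (∑ i, ∑ j, ∑ k, T i j k ^2) =
      (T 0 0 0^2 + 3*T 1 1 0^2 + 3*T 2 2 0^2) + (T 1 1 1^2 + 3*T 0 0 1^2 + 3*T 2 2 1^2)
      + (T 2 2 2^2 + 3*T 0 0 2^2 + 3*T 1 1 2^2) + 6*T 0 1 2^2 := by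
    have a1 : T 0 1 0 = T 0 0 1 := hT2 _ _ _
    have a2 : T 1 0 0 = T 0 0 1 := by rw [hT1, hT2]
    have a3 : T 0 2 0 = T 0 0 2 := hT2 _ _ _
    have a4 : T 2 0 0 = T 0 0 2 := by rw [hT1, hT2]
    have a5 : T 1 0 1 = T 1 1 0 := hT2 _ _ _
    have a6 : T 0 1 1 = T 1 1 0 := by rw [hT1, hT2]
    have a7 : T 1 2 1 = T 1 1 2 := hT2 _ _ _
    have a8 : T 2 1 1 = T 1 1 2 := by rw [hT1, hT2]
    have a9 : T 2 0 2 = T 2 2 0 := hT2 _ _ _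
    have b1 : T 0 2 2 = T 2 2 0 := by rw [hT1, hT2]
    have b2 : T 2 1 2 = T 2 2 1 := hT2 _ _ _
    have b3 : T 1 2 2 = T 2 2 1 := by rw [hT1, hT2]
    have b4 : T 0 2 1 = T 0 1 2 := hT2 _ _ _
    have b5 : T 1 0 2 = T 0 1 2 := hT1 _ _ _
    have b6 : T 1 2 0 = T 0 1 2 := by rw [hT2, hT1]
    have b7 : T 2 0 1 = T 0 1 2 := by rw [hT1, hT2]
    have b8 : T 2 1 0 = T 0 1 2 := by rw [hT2, hT1, hT2]
    simp only [Fin.sum_univ_three, a1,a2,a3,a4,a5,a6,a7,a8,a9,b1,b2,b3,b4,b5,b6,b7,b8]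
    ring
  set F0 := σ - l 0 with hF0
  set F1 := σ - l 1 with hF1
  set F2 := σ - l 2 with hF2
  obtain ⟨q, hq⟩ : ∃ q : Fin 3 → ℝ, ∀ k, t k = σ * q k := ⟨fun k => t k / σ, fun k => by field_simp⟩
  have hq' : ∀ k, t k / σ = q k := fun k => by rw [hq]; field_simp
  have hq2 : ∀ k, t k^2 / σ^2 = q k^2 := fun k => by rw [hq]; field_simp
  have hFS : (7/6) * (F0*q 0^2 + F1*q 1^2+F2*q 2^2) * σ + σ*(B 0 * q 0 + B 1 * q 1 + B 2 * q 2)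
      - 730*K^7*σ^2 ≤ F0*S 0 + F1*S 1+F2*S 2 := by
    have e : ∀ F k, (7/6) * (F/σ) * t k^2 = (7/6)*F*q k^2*σ := fun F k => by rw [hq]; field_simp
    rw [e] at J0 J1 J2
    have g0 : K * φ 0^2 ≤ K*(4*K^6*σ^2) := mul_le_mul_of_nonneg_left (hφb 0) hK0.le
    have g1 : K * φ 1^2 ≤ K*(4*K^6*σ^2) := mul_le_mul_of_nonneg_left (hφb 1) hK0.le
    have g2 : K * φ 2^2 ≤ K*(4*K^6*σ^2) := mul_le_mul_of_nonneg_left (hφb 2) hK0.le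
    have e5 : K^5*σ^2 ≤ K^7*σ^2 := by
      have : K^5 ≤ K^7 := pow_le_pow_right₀ hK (by norm_num)
      nlinarith [sq_nonneg σ]
    rw [hTsum] at hφ2
    have e6 : B 0 * t 0 + B 1 * t 1 + B 2 * t 2 = σ*(B 0 * q 0 + B 1 * q 1 + B 2 * q 2) := by
      rw [hq 0, hq 1, hq 2]; ring
    rw [e6] at hDφ
    have := sq_nonneg (T 0 1 2)
    have e7 : K*(4*K^6*σ^2) = 4*(K^7*σ^2) := by ring
    rw [e7] at g0 g1 g2
    linarith
  have hFS' : (7/6) * (F0*q 0^2 + F1*q 1^2+F2*q 2^2) + (B 0 * q 0 + B 1 * q 1 + B 2 * q 2)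
      - 730*K^7*σ ≤ (F0*S 0 + F1*S 1+F2*S 2)/σ := by
    rw [le_div_iff₀ hσ0]; linarith
  -- weighted sum
  have w0 := mul_nonpos_of_nonneg_of_nonpos L0.2.2.1.le (h2nd 0)
  have w1 := mul_nonpos_of_nonneg_of_nonpos L1.2.2.1.le (h2nd 1)
  have w2 := mul_nonpos_of_nonneg_of_nonpos L2.2.2.1.le (h2nd 2)
  simp only [hq', hq2] at w0 w1 w2 h1st ⊢
  have hsumT : ∀ i, F0 * T i 0 0 + F1 * T i 1 1 + F2 * T i 2 2 = φ i := by
    intro i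
    rw [← hφ1 i, hT1 0 0 i, hT2 0 0 i, hT1 0 i 0, hT2 1 1 i, hT1 1 i 1, hT2 2 2 i, hT1 2 i 2]
  have W : -8*σ/ρ - 8*(F0 * x 0^2 + F1 * x 1^2 + F2 * x 2^2)/ρ^2 + 2*α*f
      + β * (F0 * l 0^2 + F1 * l 1^2 + F2 * l 2^2)
      + ((α * x 0 + β * p 0) * φ 0 + (α * x 1 + β * p 1) * φ 1 + (α * x 2 + β * p 2) * φ 2)
      + ((F0*S 0 + F1*S 1+F2*S 2)/σ)/b - (F0*q 0^2 + F1*q 1^2+F2*q 2^2)/b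
      - (F0*q 0^2 + F1*q 1^2+F2*q 2^2)/b^2 ≤ 0 := by
    have s1 : F0 + F1 + F2 = 2*σ := by rw [hF0, hF1, hF2, hσ]; ring
    have s2 : F0 * l 0 + F1 * l 1 + F2 * l 2 = 2*f := by rw [hF0, hF1, hF2, hσ, hfd]; ring
    refine le_trans (le_of_eq ?_) (add_nonpos (add_nonpos w0 w1) w2)
    rw [← hsumT 0, ← hsumT 1, ← hsumT 2, show 2*α*f = α*(2*f) by ring, ← s2, show -8*σ/ρ = -4*(2*σ)/ρ by ring, ← s1]
    ring
  have hFSb : ((7/6) * (F0*q 0^2 + F1*q 1^2+F2*q 2^2) + (B 0 * q 0 + B 1 * q 1 + B 2 * q 2)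
      - 730*K^7*σ)/b ≤ ((F0*S 0 + F1*S 1+F2*S 2)/σ)/b := by gcongr
  have hcφ : ∀ k, 4 * B k * x k/ρ - B k * q k / b - K^2 ≤ (α * x k + β * p k) * φ k := by
    intro k
    have e1 : (α * x k + β * p k) * l k = 4*x k/ρ - q k/b := by linear_combination h1st k
    have e2 : -(K^2) ≤ (α * x k + β * p k) * A k := by
      have : |(α * x k + β * p k) * A k| ≤ 1*K^2 := by
        rw [abs_mul]; exact mul_le_mul (hc k) (hA k) (abs_nonneg _) zero_le_one
      linarith [neg_abs_le ((α * x k + β * p k) * A k)]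
    rw [hφA]
    have e3 : (α * x k + β * p k) * (A k + B k * l k) = (α * x k + β * p k) * A k + B k * (4*x k/ρ - q k/b) := by
      rw [← e1]; ring
    rw [e3]
    have e4 : B k * (4*x k/ρ - q k/b) = 4 * B k * x k/ρ - B k * q k / b := by ring
    linarith
  have hBx : ∀ k, -(32*K/ρ) ≤ 4 * B k * x k/ρ := by
    intro k
    rw [neg_div', div_le_div_iff_of_pos_right hρ]
    have : |B k * x k| ≤ K*8 := by
      rw [abs_mul]; exact mul_le_mul (hB k) (hx k) (abs_nonneg _) hK0.le
    have e : 4 * B k * x k = 4 * (B k * x k) := by ring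
    rw [e]
    have := neg_abs_le (B k * x k)
    linarith
  have c0 := hcφ 0
  have c1 := hcφ 1
  have c2 := hcφ 2
  have d0 := hBx 0
  have d1 := hBx 1
  have d2 := hBx 2
  have hαf : 0 ≤ 2*α*f := by positivity
  have h96 : 0 ≤ K/ρ := by positivity
  have x1 : 100*K/ρ = 100*(K/ρ) := by ring
  have x2 : 32*K/ρ = 32*(K/ρ) := by ring
  rw [x2] at d0 d1 d2
  rw [x1]
  have x3 : ((7/6) * (F0*q 0^2 + F1*q 1^2+F2*q 2^2) + (B 0 * q 0 + B 1 * q 1 + B 2 * q 2)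
      - 730*K^7*σ)/b = (7/6) * ((F0*q 0^2 + F1*q 1^2+F2*q 2^2)/b) + (B 0 * q 0/b + B 1 * q 1/b + B 2 * q 2/b) - 730*K^7*σ/b := by ring
  rw [x3] at hFSb
  have x4 : (1/6/b - 1/b^2) * (F0*q 0^2 + F1*q 1^2+F2*q 2^2) = 1/6*((F0*q 0^2 + F1*q 1^2+F2*q 2^2)/b) - (F0*q 0^2 + F1*q 1^2+F2*q 2^2)/b^2 := by ring
  rw [x4]
  have x5 : -8*σ/ρ = -(8*σ/ρ) := by ring
  rw [x5] at W
  linarith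

set_option maxHeartbeats 1000000 in
lemma alg_contra (K β κ N ρ b σ : ℝ) (l t x p : Fin 3 → ℝ)
    (hK : 1 ≤ K) (hρ : 0 < ρ) (hρ' : ρ ≤ 64) (hκ : κ = 64*(2300*K^7)) (hβ : β * (2178*κ*K^2) = 1)
    (hN1 : 24*4096*κ ≤ N) (hN2 : 64*384*(2300*K^7) < N * (β^2*K)) (hN3 : 8192 ≤ N * β)
    (hbN : N < b * ρ^2) (hσb : b ≤ K * σ)
    (hσ : σ = l 0 + l 1 + l 2) (hσ0 : 0 < σ)
    (hf : 1/K ≤ l 0 * l 1 + l 0 * l 2 + l 1 * l 2)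
    (hx : ∀ k, |x k| ≤ 8) (hp : ∀ k, |p k| ≤ K) (hx1 : 1 ≤ x 0^2 + x 1^2 + x 2^2)
    (h1st : ∀ k, -4 * x k / ρ + (4*K*β * x k + β * p k) * l k + t k / σ / b = 0)
    (hmain : β * ((σ - l 0) * l 0^2 + (σ - l 1) * l 1^2 + (σ - l 2) * l 2^2)
      + (1/6/b - 1/b^2) * ((σ - l 0) * (t 0/σ)^2 + (σ - l 1) * (t 1/σ)^2 + (σ - l 2) * (t 2/σ)^2)
    ≤ 8*σ/ρ + 8*((σ - l 0) * x 0^2 + (σ - l 1) * x 1^2 + (σ - l 2) * x 2^2)/ρ^2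
      + 100*K/ρ + 3*K^2 + 730*K^7*σ/b) : False := by
  have hK0 : 0 < K := by linarith
  have hK7 : 1 ≤ K^7 := one_le_pow₀ hK
  have hκ1 : 1 ≤ κ := by rw [hκ]; linarith
  have hβ0 : 0 < β := by
    by_contra h
    push Not at h
    have : β * (2178*κ*K^2) ≤ 0 := mul_nonpos_of_nonpos_of_nonneg h (by positivity)
    linarith
  have L0 := lam_bds K (l 0) (l 1) (l 2) hK (by linarith) (by linarith)
  have L1 := lam_bds K (l 1) (l 0) (l 2) hK (by linarith) (by linarith)
  have L2 := lam_bds K (l 2) (l 0) (l 1) hK (by linarith) (by linarith)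
  rw [← hσ] at L0
  rw [show l 1 + l 0 + l 2 = σ by rw [hσ]; ring] at L1
  rw [show l 2 + l 0 + l 1 = σ by rw [hσ]; ring] at L2
  have hKσ : 1 ≤ K * σ := L0.2.2.2
  have hF : ∀ k, 0 < σ - l k := by
    intro k; fin_cases k
    exacts [L0.2.2.1, L1.2.2.1, L2.2.2.1]
  have hF' : ∀ k, 1 ≤ K * σ * (σ - l k) := by
    intro k; fin_cases k
    exacts [L0.2.1, L1.2.1, L2.2.1]
  have hρ2 : ρ^2 ≤ 4096 := by nlinarith
  have hb : 24*κ ≤ b := by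
    by_contra h
    push Not at h
    have : b * ρ^2 ≤ 24*κ*4096 := by
      refine mul_le_mul h.le hρ2 (by positivity) (by positivity)
    linarith
  have hb0 : 0 < b := by linarith
  -- y
  obtain ⟨y, hy⟩ : ∃ y : Fin 3 → ℝ, ∀ k, y k = 4 * x k/ρ - (4*K*β * x k + β * p k) * l k := ⟨_, fun k => rfl⟩
  have hty : ∀ k, t k/σ = b * y k := by
    intro k
    have : t k/σ/b = y k := by rw [hy]; linear_combination h1st k
    rw [← this]; field_simp
  obtain ⟨c, hcd⟩ : ∃ c : Fin 3 → ℝ, ∀ k, c k = 4*K*β * x k + β * p k := ⟨_, fun k => rfl⟩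
  have hcb : ∀ k, |c k| ≤ 33*K*β := by
    intro k
    rw [hcd]
    refine (abs_add_le _ _).trans ?_
    rw [abs_mul, abs_mul β, abs_of_pos hβ0, abs_of_pos (by positivity : 0 < 4*K*β)]
    have := mul_le_mul_of_nonneg_left (hx k) (by positivity : 0 ≤ 4*K*β)
    have := mul_le_mul_of_nonneg_left (hp k) hβ0.le
    linarith
  have hc2 : ∀ k, κ * c k^2 ≤ β/2 := by
    intro k
    have h1 : c k^2 ≤ (33*K*β)^2 := sq_le_sq' (by linarith [neg_abs_le (c k), hcb k]) ((le_abs_self _).trans (hcb k))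
    have h2 : κ * c k^2 ≤ κ * (33*K*β)^2 := mul_le_mul_of_nonneg_left h1 (by linarith)
    have h3 : κ * (33*K*β)^2 = β/2 * (β * (2178*κ*K^2)) := by ring
    rw [h3, hβ] at h2
    linarith
  have hxy : ∀ k, 8 * x k^2/ρ^2 ≤ y k^2 + c k^2 * l k^2 := by
    intro k
    have h1 : 4 * x k/ρ = y k + c k * l k := by rw [hy, hcd]; ring
    have h2 : 8 * x k^2/ρ^2 = (4 * x k/ρ)^2/2 := by ring
    rw [h2, h1]
    have := sq_nonneg (y k - c k * l k)
    have e : (y k + c k * l k)^2/2 = y k^2 + c k^2*l k^2 - (y k - c k * l k)^2/2 := by ring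
    linarith
  have hFxy : ∀ k, 8*((σ - l k) * x k^2)/ρ^2 ≤ (σ - l k) * y k^2 + β/2*((σ - l k) * l k^2) := by
    intro k
    have h1 := mul_le_mul_of_nonneg_left (hxy k) (hF k).le
    have h2 : c k^2 ≤ β/2 := by
      have h5 := hc2 k
      have := mul_le_mul_of_nonneg_right hκ1 (sq_nonneg (c k))
      linarith
    have h3 : c k^2*((σ - l k) * l k^2) ≤ β/2*((σ - l k) * l k^2) :=
      mul_le_mul_of_nonneg_right h2 (mul_nonneg (hF k).le (sq_nonneg _))
    have h4 : 8*((σ - l k) * x k^2)/ρ^2 = (σ - l k) * (8 * x k^2/ρ^2) := by ring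
    rw [h4]
    linarith
  have hσρ : σ ≤ 64*(σ/ρ) := by
    have : σ/ρ*ρ = σ := by field_simp
    have h0 : 0 < σ/ρ := by positivity
    have := mul_le_mul_of_nonneg_left hρ' h0.le
    linarith
  have key : ∀ k, β/2*((σ - l k) * l k^2) + b/24*((σ - l k) * y k^2) ≤ 2300*K^7*(σ/ρ) := by
    have hnn : ∀ k, 0 ≤ β/2*((σ - l k) * l k^2) + b/24*((σ - l k) * y k^2) := by
      intro k
      have := hF k
      positivity
    have hsum : (β/2*((σ - l 0) * l 0^2) + b/24*((σ - l 0) * y 0^2))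
        + (β/2*((σ - l 1) * l 1^2) + b/24*((σ - l 1) * y 1^2))
        + (β/2*((σ - l 2) * l 2^2) + b/24*((σ - l 2) * y 2^2)) ≤ 2300*K^7*(σ/ρ) := by
      simp only [hty] at hmain
      have e1 : (1/6/b - 1/b^2) * ((σ - l 0) * (b * y 0)^2 + (σ - l 1) * (b * y 1)^2 + (σ - l 2) * (b * y 2)^2)
          = (b/6 - 1) * ((σ - l 0) * y 0^2 + (σ - l 1) * y 1^2 + (σ - l 2) * y 2^2) := by
        field_simp
      rw [e1] at hmain
      have e2 : 8*((σ - l 0) * x 0^2 + (σ - l 1) * x 1^2 + (σ - l 2) * x 2^2)/ρ^2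
        = 8*((σ - l 0) * x 0^2)/ρ^2 + 8*((σ - l 1) * x 1^2)/ρ^2 + 8*((σ - l 2) * x 2^2)/ρ^2 := by ring
      rw [e2] at hmain
      have f0 := hFxy 0
      have f1 := hFxy 1
      have f2 := hFxy 2
      have hy0 : 0 ≤ (σ - l 0) * y 0^2 + (σ - l 1) * y 1^2 + (σ - l 2) * y 2^2 := by
        have := hF 0
        have := hF 1
        have := hF 2
        positivity
      have hby : (b/24) * ((σ - l 0) * y 0^2 + (σ - l 1) * y 1^2 + (σ - l 2) * y 2^2)
        ≤ (b/6-2) * ((σ - l 0) * y 0^2 + (σ - l 1) * y 1^2 + (σ - l 2) * y 2^2) := by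
        apply mul_le_mul_of_nonneg_right _ hy0
        linarith
      have hq0 : 0 < σ/ρ := by positivity
      have r1 : 8*σ/ρ ≤ 8*K^7*(σ/ρ) := by
        have : 8*σ/ρ = 8*(σ/ρ) := by ring
        rw [this]
        have := mul_le_mul_of_nonneg_right hK7 hq0.le
        linarith
      have r2 : 100*K/ρ ≤ 100*K^7*(σ/ρ) := by
        have : 100*K/ρ ≤ 100*(K^2*σ)/ρ := by
          gcongr
          have := mul_le_mul_of_nonneg_left hKσ hK0.le
          linarith
        have h2 : 100*(K^2*σ)/ρ = 100*K^2*(σ/ρ) := by ring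
        have h3 : K^2 ≤ K^7 := pow_le_pow_right₀ hK (by norm_num)
        rw [h2] at this
        have := mul_le_mul_of_nonneg_right h3 hq0.le
        linarith
      have r3 : 3*K^2 ≤ 192*K^7*(σ/ρ) := by
        have h1 : 3*K^2 ≤ 3*K^3*σ := by
          have := mul_le_mul_of_nonneg_left hKσ (sq_nonneg K)
          linarith
        have h3 : K^3 ≤ K^7 := pow_le_pow_right₀ hK (by norm_num)
        have h4 : K^3*σ ≤ K^7*σ := mul_le_mul_of_nonneg_right h3 hσ0.le
        have h5 : K^7*σ ≤ K^7*(64*(σ/ρ)) := mul_le_mul_of_nonneg_left hσρ (by positivity)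
        linarith
      have r4 : 730*K^7*σ/b ≤ 2000*K^7*(σ/ρ) := by
        have h1 : 730*K^7*σ/b ≤ 730*K^7*σ/24 := by
          gcongr
          linarith
        have h5 : K^7*σ ≤ K^7*(64*(σ/ρ)) := mul_le_mul_of_nonneg_left hσρ (by positivity)
        have h6 : 0 ≤ K^7*(σ/ρ) := by positivity
        linarith
      linarith
    intro k
    have n0 := hnn 0
    have n1 := hnn 1
    have n2 := hnn 2
    fin_cases k <;> simp only [Fin.zero_eta, Fin.mk_one, Fin.reduceFinMk] <;> linarith
  -- choose index
  obtain ⟨i, hi⟩ : ∃ i, 1/3 ≤ x i^2 := by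
    by_contra h
    push Not at h
    have := h 0
    have := h 1
    have := h 2
    linarith
  have hkey := key i
  have hFi := hF i
  rcases le_total (σ/2) (σ - l i) with hA | hB
  · -- case A
    have h1 : κ * (y i^2 + c i^2 * l i^2) ≤ β/2 * l i^2 + b/24 * y i^2 := by
      have a1 := mul_le_mul_of_nonneg_right (hc2 i) (sq_nonneg (l i))
      have a2 : κ * y i^2 ≤ b/24 * y i^2 := mul_le_mul_of_nonneg_right (by linarith) (sq_nonneg _)
      linarith
    have h2 : κ * (8 * x i^2/ρ^2) ≤ β/2 * l i^2 + b/24 * y i^2 :=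
      (mul_le_mul_of_nonneg_left (hxy i) (by linarith)).trans h1
    have h3 : κ * (8/3/ρ^2) ≤ β/2 * l i^2 + b/24 * y i^2 := by
      refine le_trans ?_ h2
      apply mul_le_mul_of_nonneg_left _ (by linarith)
      gcongr
      linarith
    have h4 : (σ/2) * (κ * (8/3/ρ^2)) ≤ 2300*K^7*(σ/ρ) := by
      have := mul_le_mul hA h3 (by positivity) hFi.le
      refine this.trans (le_trans (le_of_eq ?_) hkey)
      ring
    have h5 : (σ/2) * (κ * (8/3/ρ^2)) = (σ/ρ^2)*(κ*4/3) := by ring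
    have h6 : 2300*K^7*(σ/ρ) = (σ/ρ^2)*(2300*K^7*ρ) := by field_simp
    rw [h5, h6] at h4
    have h7 := le_of_mul_le_mul_left h4 (by positivity)
    have h8 : 2300*K^7*ρ ≤ 2300*K^7*64 := mul_le_mul_of_nonneg_left hρ' (by positivity)
    linarith
  · -- case B
    have hl : σ/2 ≤ l i := by linarith
    have hxi : 1/2 ≤ |x i| := by
      by_contra h
      push Not at h
      have : |x i|^2 < (1/2)^2 := by
        apply pow_lt_pow_left₀ h (abs_nonneg _) (by norm_num)
      rw [sq_abs] at this
      linarith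
    have hci : β*K ≤ |c i| := by
      have h1 : |4*K*β*x i| - |β * p i| ≤ |c i| := by
        rw [hcd]
        have := abs_sub_abs_le_abs_sub (4*K*β*x i) (-(β * p i))
        rw [abs_neg, sub_neg_eq_add] at this
        exact this
      rw [abs_mul, abs_mul β, abs_of_pos hβ0, abs_of_pos (by positivity : 0 < 4*K*β)] at h1
      have := mul_le_mul_of_nonneg_left hxi (by positivity : 0 ≤ 4*K*β)
      have := mul_le_mul_of_nonneg_left (hp i) hβ0.le
      linarith
    have hcl : β*K*(σ/2) ≤ |c i * l i| := by
      rw [abs_mul]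
      exact mul_le_mul hci (hl.trans (le_abs_self _)) (by positivity) (abs_nonneg _)
    have hbρ : N/64 ≤ b * ρ := by
      have : b*ρ^2 ≤ b*ρ*64 := by
        have := mul_le_mul_of_nonneg_left hρ' (by positivity : 0 ≤ b*ρ)
        linarith
      linarith
    have hyi : β*K*σ/4 ≤ |y i| := by
      have h1 : |c i * l i| - |4 * x i/ρ| ≤ |y i| := by
        have := abs_sub_abs_le_abs_sub (c i * l i) (4*x i/ρ)
        rw [abs_sub_comm] at this
        rwa [hy, ← hcd]
      have h2 : |4 * x i/ρ| ≤ 32/ρ := by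
        rw [abs_div, abs_of_pos hρ, abs_mul]
        gcongr
        rw [abs_of_pos (by norm_num : (0:ℝ) < 4)]
        linarith [hx i]
      have h3 : 32/ρ ≤ β*K*σ/4 := by
        rw [div_le_iff₀ hρ]
        have a1 : N/64 ≤ K*σ*ρ := hbρ.trans (mul_le_mul_of_nonneg_right hσb hρ.le)
        have a2 := mul_le_mul_of_nonneg_left a1 hβ0.le
        linarith
      linarith
    have hyi2 : (β*K*σ/4)^2 ≤ y i^2 := by
      rw [← sq_abs (y i)]
      exact pow_le_pow_left₀ (by positivity) hyi 2
    have h1 : b/24*((σ - l i) * y i^2) ≤ 2300*K^7*(σ/ρ) := by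
      have : 0 ≤ β/2*((σ - l i) * l i^2) := by positivity
      linarith
    have h2 : b/24*((σ - l i) * (β*K*σ/4)^2) ≤ 2300*K^7*(σ/ρ) := by
      refine le_trans ?_ h1
      gcongr
    have h3 : b*(β^2*K*σ)/384 ≤ 2300*K^7*(σ/ρ) := by
      refine le_trans ?_ h2
      have e : b/24*((σ - l i) * (β*K*σ/4)^2) = b*(β^2*K*σ)/384*(K * σ * (σ - l i)) := by ring
      rw [e]
      exact le_mul_of_one_le_right (by positivity) (hF' i)
    have h4 : b*(β^2*K*σ)/384 * ρ ≤ 2300*K^7*σ := by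
      have := mul_le_mul_of_nonneg_right h3 hρ.le
      have e : 2300*K^7*(σ/ρ)*ρ = 2300*K^7*σ := by field_simp
      rwa [e] at this
    have h5 : σ * (b*ρ*(β^2*K)) ≤ σ * (384*(2300*K^7)) := by linarith
    have h6 := le_of_mul_le_mul_left h5 hσ0
    have h7 : N/64*(β^2*K) ≤ b*ρ*(β^2*K) := mul_le_mul_of_nonneg_right hbρ (by positivity)
    linarith

/-! ### Chain rule for `f(x,u,Du)` -/

lemma fderiv_triple {q : E3 → E3} {a : E3 → ℝ} {h : Fin 3 → E3 → ℝ} {x : E3} (k : Fin 3)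
    (hq : DifferentiableAt ℝ q x) (ha : DifferentiableAt ℝ a x)
    (hh : ∀ l, DifferentiableAt ℝ (h l) x) :
    DifferentiableAt ℝ (fun y => (q y, a y, ∑ l, h l y • ee l)) x ∧
    fderiv ℝ (fun y => (q y, a y, ∑ l, h l y • ee l)) x (ee k)
      = (fderiv ℝ q x (ee k), pd k a x, ∑ l, pd k (h l) x • ee l) := by
  have h1 : HasFDerivAt (fun y => ∑ l, h l y • ee l)
      (∑ l, (fderiv ℝ (h l) x).smulRight (ee l)) x :=
    HasFDerivAt.fun_sum fun l _ => (hh l).hasFDerivAt.smul_const (ee l)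
  have h2 := hq.hasFDerivAt.prodMk (ha.hasFDerivAt.prodMk h1)
  refine ⟨h2.differentiableAt, ?_⟩
  rw [h2.fderiv]
  simp [pd]

lemma grad_eq_sum (u : E3 → ℝ) (x : E3) : grad u x = ∑ l, pd l u x • ee l := by
  ext i
  simp [grad, Fin.sum_univ_three]
  fin_cases i <;> simp

lemma jet_comp (f : E3 × ℝ × E3 → ℝ) (u : E3 → ℝ) (hf : ContDiff ℝ 2 f) {x : E3}
    (hu : ∀ᶠ y in nhds x, ContDiffAt ℝ (⊤ : ℕ∞) u y) (k : Fin 3) :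
    pd k (fun y => f (y, u y, grad u y)) x =
      fderiv ℝ f (x, u x, grad u x) (ee k, pd k u x, ∑ l, pd k (pd l u) x • ee l) ∧
    pd k (pd k (fun y => f (y, u y, grad u y))) x =
      fderiv ℝ (fderiv ℝ f) (x, u x, grad u x) (ee k, pd k u x, ∑ l, pd k (pd l u) x • ee l)
        (ee k, pd k u x, ∑ l, pd k (pd l u) x • ee l)
      + fderiv ℝ f (x, u x, grad u x) (0, pd k (pd k u) x, ∑ l, pd k (pd k (pd l u)) x • ee l) := by
  have hd : ∀ {g : E3 → ℝ} {y}, ContDiffAt ℝ (⊤ : ℕ∞) g y → DifferentiableAt ℝ g y :=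
    fun h => h.differentiableAt (by simp)
  set G : E3 → E3 × ℝ × E3 := fun y => (y, u y, ∑ l, pd l u y • ee l) with hG
  have hGe : (fun y => f (y, u y, grad u y)) = fun y => f (G y) := by
    funext y; rw [grad_eq_sum]
  have hGx : (x, u x, grad u x) = G x := by rw [grad_eq_sum]
  rw [hGe, hGx]
  set V : E3 → E3 × ℝ × E3 := fun y => (ee k, pd k u y, ∑ l, pd k (pd l u) y • ee l) with hV
  have hfd : Differentiable ℝ f := hf.differentiable (by norm_num)
  have hfd2 : Differentiable ℝ (fderiv ℝ f) :=
    (hf.fderiv_right (m := 1) (by norm_num [one_add_one_eq_two])).differentiable (by norm_num)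
  have e1 : ∀ y, ContDiffAt ℝ (⊤ : ℕ∞) u y → DifferentiableAt ℝ G y ∧
      fderiv ℝ G y (ee k) = V y := by
    intro y hy
    have := fderiv_triple (q := id) (a := u) (h := fun l => pd l u) k differentiableAt_id (hd hy)
      (fun l => hd (pd_smooth l hy))
    refine ⟨this.1, this.2.trans ?_⟩
    simp [hV]
  have e2 : ∀ y, ContDiffAt ℝ (⊤ : ℕ∞) u y → pd k (fun y => f (G y)) y = fderiv ℝ f (G y) (V y) := by
    intro y hy
    have h1 := (hfd (G y)).hasFDerivAt.comp y (e1 y hy).1.hasFDerivAt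
    have h2 : fderiv ℝ (fun y => f (G y)) y = _ := h1.fderiv
    rw [pd, h2]
    change fderiv ℝ f (G y) (fderiv ℝ G y (ee k)) = _
    rw [(e1 y hy).2]
  have hux := hu.self_of_nhds
  refine ⟨e2 x hux, ?_⟩
  have e3 : pd k (fun y => f (G y)) =ᶠ[nhds x] fun y => fderiv ℝ f (G y) (V y) := by
    filter_upwards [hu] with y hy using e2 y hy
  rw [pd_congr k e3]
  have hVd := fderiv_triple (q := fun _ => ee k) (a := pd k u) (h := fun l => pd k (pd l u)) (x := x) k
      (differentiableAt_const _) (hd (pd_smooth k hux)) (fun l => hd (pd_smooth k (pd_smooth l hux)))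
  have hc : HasFDerivAt (fun y => fderiv ℝ f (G y)) ((fderiv ℝ (fderiv ℝ f) (G x)).comp (fderiv ℝ G x)) x :=
    (hfd2 (G x)).hasFDerivAt.comp x (e1 x hux).1.hasFDerivAt
  have h4 := hc.clm_apply hVd.1.hasFDerivAt
  have h5 : fderiv ℝ (fun y => fderiv ℝ f (G y) (V y)) x = _ := h4.fderiv
  rw [pd, h5]
  have h6 : fderiv ℝ V x (ee k) = (0, pd k (pd k u) x, ∑ l, pd k (pd k (pd l u)) x • ee l) := by
    refine hVd.2.trans ?_
    simp
  change fderiv ℝ f (G x) (fderiv ℝ V x (ee k)) + fderiv ℝ (fderiv ℝ f) (G x) (fderiv ℝ G x (ee k)) (V x) = _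
  rw [h6, (e1 x hux).2, add_comm]

lemma f_bounds (K : ℝ) (f : E3 × ℝ × E3 → ℝ) (z : E3 × ℝ × E3)
    (hb : ∀ k : ℕ, k ≤ 2 → ‖iteratedFDeriv ℝ k f z‖ ≤ K) :
    (∀ v, |fderiv ℝ f z v| ≤ K * ‖v‖) ∧ (∀ v, |fderiv ℝ (fderiv ℝ f) z v v| ≤ K * ‖v‖^2) := by
  constructor
  · intro v
    have h1 := hb 1 (by norm_num)
    rw [norm_iteratedFDeriv_one] at h1
    exact (fderiv ℝ f z).le_of_opNorm_le h1 v
  · intro v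
    have h2 := hb 2 le_rfl
    have h3 := (iteratedFDeriv ℝ 2 f z).le_of_opNorm_le h2 ![v, v]
    rw [iteratedFDeriv_two_apply] at h3
    simpa [Fin.prod_univ_two, pow_two] using h3

/-- bounds at a point where the Hessian is diagonal -/
lemma phi_bounds (K σ : ℝ) (f : E3 × ℝ × E3 → ℝ) (u : E3 → ℝ) (hf : ContDiff ℝ 2 f) {x : E3}
    (hK : 1 ≤ K) (hb : ∀ z, ∀ k : ℕ, k ≤ 2 → ‖iteratedFDeriv ℝ k f z‖ ≤ K)
    (hu : ∀ᶠ y in nhds x, ContDiffAt ℝ (⊤ : ℕ∞) u y)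
    (l : Fin 3 → ℝ) (hl : ∀ i j, pd i (pd j u) x = if i = j then l i else 0)
    (hlσ : ∀ k, |l k| ≤ σ) (hσ : l 0 + l 1 + l 2 = σ) (hKσ : 1 ≤ K * σ)
    (hp : ∀ k, |pd k u x| ≤ K) :
    ∃ A B : Fin 3 → ℝ, (∀ k, |A k| ≤ K^2) ∧ (∀ k, |B k| ≤ K) ∧
      (∀ k, pd k (fun y => f (y, u y, grad u y)) x = A k + B k * l k) ∧
      (∑ m, B m * (∑ k, pd k (pd k (pd m u)) x)) - 10*K^5*σ^2 ≤
        ∑ k, pd k (pd k (fun y => f (y, u y, grad u y))) x := by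
  obtain ⟨D1, D2⟩ := f_bounds K f (x, u x, grad u x) (hb _)
  have hK0 : 0 < K := by linarith
  have hσ0 : 0 ≤ σ := (abs_nonneg _).trans (hlσ 0)
  have J := jet_comp f u hf hu
  set z := (x, u x, grad u x) with hz
  set D := fderiv ℝ f z with hD
  have hsum : ∀ c : Fin 3 → ℝ, ∀ (v : E3) (r : ℝ), D (v, r, ∑ m, c m • ee m) =
      D (v, r, 0) + ∑ m, D (0, 0, ee m) * c m := by
    intro c v r
    have : (v, r, ∑ m, c m • ee m) = (v, r, (0:E3)) + ∑ m, c m • ((0:E3), (0:ℝ), ee m) := by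
      simp [Fin.sum_univ_three]
    rw [this, map_add, map_sum]
    congr 1
    refine Finset.sum_congr rfl fun m _ => ?_
    rw [map_smul, smul_eq_mul, mul_comm]
  have hV : ∀ k, (∑ m, pd k (pd m u) x • ee m) = l k • ee k := by
    intro k
    simp [hl]
  have hVnorm : ∀ k, ‖((ee k, pd k u x, ∑ m, pd k (pd m u) x • ee m) : E3 × ℝ × E3)‖^2
      ≤ 1 + K^2 + σ^2 := by
    intro k
    rw [hV]
    simp only [Prod.norm_mk, norm_smul]
    have e1 : ‖ee k‖ = 1 := by simp
    rw [e1]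
    have h1 : ‖pd k u x‖^2 ≤ K^2 := pow_le_pow_left₀ (norm_nonneg _) (hp k) 2
    have h2 : (‖l k‖*1)^2 ≤ σ^2 := pow_le_pow_left₀ (by positivity) (by rw [mul_one]; exact hlσ k) 2
    rcases max_choice (1:ℝ) (max ‖pd k u x‖ (‖l k‖*1)) with h | h <;> rw [h]
    · nlinarith
    · rcases max_choice (‖pd k u x‖) (‖l k‖*1) with h | h <;> rw [h] <;> nlinarith
  refine ⟨fun k => D (ee k, pd k u x, 0), fun k => D (0, 0, ee k), ?_, ?_, ?_, ?_⟩
  · intro k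
    refine (D1 _).trans ?_
    have : ‖((ee k, pd k u x, 0) : E3 × ℝ × E3)‖ ≤ K := by
      simp only [Prod.norm_mk]
      refine max_le (by simpa using hK) (max_le (hp k) (by simpa using hK0.le))
    nlinarith
  · intro k
    refine (D1 _).trans ?_
    have : ‖((0, 0, ee k) : E3 × ℝ × E3)‖ ≤ 1 := by
      simp [Prod.norm_mk]
    nlinarith
  · intro k
    rw [(J k).1, hsum]
    simp [hl]
  · have hk : ∀ k, (∑ m, D (0,0,ee m) * pd k (pd k (pd m u)) x) + D (0, 1, 0) * l k - K*(1+K^2+σ^2) ≤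
        pd k (pd k (fun y => f (y, u y, grad u y))) x := by
      intro k
      rw [(J k).2, hsum]
      have h1 := (neg_abs_le _).trans' (neg_le_neg (D2 (ee k, pd k u x, ∑ m, pd k (pd m u) x • ee m)))
      have h2 := mul_le_mul_of_nonneg_left (hVnorm k) hK0.le
      have h3 : D (0, pd k (pd k u) x, 0) = D (0, 1, 0) * l k := by
        have : ((0, pd k (pd k u) x, 0) : E3 × ℝ × E3) = l k • (0, 1, 0) := by simp [hl]
        rw [this, map_smul, smul_eq_mul, mul_comm]
      linarith
    have hD1 : |D (0,1,0)| ≤ K := by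
      refine (D1 _).trans ?_
      have : ‖((0, 1, 0) : E3 × ℝ × E3)‖ ≤ 1 := by
        simp [Prod.norm_mk]
      nlinarith
    have hS : -(K*σ) ≤ D (0,1,0) * l 0 + D (0,1,0) * l 1 + D (0,1,0) * l 2 := by
      have : D (0,1,0) * l 0 + D (0,1,0) * l 1 + D (0,1,0) * l 2 = D (0,1,0) * σ := by rw [← hσ]; ring
      rw [this]
      nlinarith [neg_abs_le (D (0,1,0))]
    have k0 := hk 0
    have k1 := hk 1
    have k2 := hk 2
    have c1 : K*σ ≤ K^5*σ^2 := by
      have : K*σ*1 ≤ K*σ*(K*σ) := mul_le_mul_of_nonneg_left hKσ (by positivity)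
      have h2 : K^2 ≤ K^5 := pow_le_pow_right₀ hK (by norm_num)
      have := mul_le_mul_of_nonneg_right h2 (sq_nonneg σ)
      linarith
    have c0 : 1 ≤ K^2*σ^2 := by
      have := one_le_pow₀ hKσ (n := 2)
      rwa [mul_pow] at this
    have c2 : K ≤ K^5*σ^2 := by
      have h2 : K^3 ≤ K^5 := pow_le_pow_right₀ hK (by norm_num)
      have := mul_le_mul_of_nonneg_right h2 (sq_nonneg σ)
      have := mul_le_mul_of_nonneg_left c0 hK0.le
      linarith
    have c3 : K^3 ≤ K^5*σ^2 := by
      have := mul_le_mul_of_nonneg_left c0 (by positivity : 0 ≤ K^3)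
      linarith
    have c4 : K*σ^2 ≤ K^5*σ^2 := by
      have h2 : K ≤ K^5 := le_self_pow₀ hK (by norm_num)
      exact mul_le_mul_of_nonneg_right h2 (sq_nonneg σ)
    simp only [Fin.sum_univ_three] at k0 k1 k2 ⊢
    linarith

/-! ### Jets of the quantities built from `u` -/

def wfun (α β : ℝ) (u : E3 → ℝ) (y : E3) : ℝ :=
  α * ((y 0 * pd 0 u y + (y 1 * pd 1 u y + y 2 * pd 2 u y)) + (-1) * u y)
    + (β/2) * (pd 0 u y * pd 0 u y + (pd 1 u y * pd 1 u y + pd 2 u y * pd 2 u y))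

def rhofun (y : E3) : ℝ := 64 + (-1) * (y 0 * y 0 + (y 1 * y 1 + y 2 * y 2))

lemma lap_eq (u : E3 → ℝ) (y : E3) :
    lap u y = pd 0 (pd 0 u) y + (pd 1 (pd 1 u) y + pd 2 (pd 2 u) y) := by
  simp [lap, hess, Fin.sum_univ_three]; ring

lemma sigma2_eq (u : E3 → ℝ) (y : E3) :
    sigma2 (hess u y) = pd 0 (pd 0 u) y * pd 1 (pd 1 u) y + (pd 0 (pd 0 u) y * pd 2 (pd 2 u) y
      + (pd 1 (pd 1 u) y * pd 2 (pd 2 u) y + (-1) * (pd 0 (pd 1 u) y * pd 1 (pd 0 u) y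
      + (pd 0 (pd 2 u) y * pd 2 (pd 0 u) y + pd 1 (pd 2 u) y * pd 2 (pd 1 u) y)))) := by
  simp [sigma2, hess, Matrix.trace, Matrix.mul_apply, Fin.sum_univ_three]; ring

lemma top2 {g : E3 → ℝ} {y : E3} (h : ContDiffAt ℝ (⊤ : ℕ∞) g y) : ContDiffAt ℝ 2 g y :=
  h.of_le (by norm_cast)

lemma T_symm1 {u : E3 → ℝ} {x : E3} (hu : ∀ᶠ y in nhds x, ContDiffAt ℝ (⊤ : ℕ∞) u y) (i j k : Fin 3) : pd i (pd j (pd k u)) x = pd j (pd i (pd k u)) x :=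
  pd_comm i j (top2 (pd_smooth k hu.self_of_nhds))

lemma T_symm2 {u : E3 → ℝ} {x : E3} (hu : ∀ᶠ y in nhds x, ContDiffAt ℝ (⊤ : ℕ∞) u y) (i j k : Fin 3) : pd i (pd j (pd k u)) x = pd i (pd k (pd j u)) x := by
  apply pd_congr
  filter_upwards [hu] with y hy using pd_comm j k (top2 hy)

lemma Q_symm {u : E3 → ℝ} {x : E3} (hu : ∀ᶠ y in nhds x, ContDiffAt ℝ (⊤ : ℕ∞) u y) 
    (i k : Fin 3) : pd i (pd i (pd k (pd k u))) x = pd k (pd k (pd i (pd i u))) x := by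
  -- i i k k -> i k i k
  have e1 : pd i (pd k (pd k u)) =ᶠ[nhds x] pd k (pd i (pd k u)) := by
    filter_upwards [hu] with y hy using pd_comm i k (top2 (pd_smooth k hy))
  have e2 : pd i (pd k u) =ᶠ[nhds x] pd k (pd i u) := by
    filter_upwards [hu] with y hy using pd_comm i k (top2 hy)
  have e3 : pd i (pd k (pd i u)) =ᶠ[nhds x] pd k (pd i (pd i u)) := by
    filter_upwards [hu] with y hy using pd_comm i k (top2 (pd_smooth i hy))
  rw [pd_congr i e1, pd_comm i k (top2 (pd_smooth i (pd_smooth k hu.self_of_nhds))),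
    pd_congr k (pd_congr' i e2), pd_congr k e3]

lemma jet_lap {u : E3 → ℝ} {x : E3} (hu : ContDiffAt ℝ (⊤ : ℕ∞) u x) (k : Fin 3) :
    Jet k (lap u) x
      (pd k (pd 0 (pd 0 u)) x + (pd k (pd 1 (pd 1 u)) x + pd k (pd 2 (pd 2 u)) x))
      (pd k (pd k (pd 0 (pd 0 u))) x + (pd k (pd k (pd 1 (pd 1 u))) x
        + pd k (pd k (pd 2 (pd 2 u))) x)) := by
  have e : lap u = fun y => pd 0 (pd 0 u) y + (pd 1 (pd 1 u) y + pd 2 (pd 2 u) y) :=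
    funext (lap_eq u)
  rw [e]
  have j : ∀ i, Jet k (pd i (pd i u)) x _ _ := fun i =>
    Jet.of k (top2 (pd_smooth i (pd_smooth i hu)))
  exact (j 0).add ((j 1).add (j 2))

lemma jet_rho (x : E3) (k : Fin 3) : Jet k rhofun x (-2 * x k) (-2) := by
  have j : ∀ l, Jet k (fun y : E3 => y l) x _ _ := fun l => Jet.coord k l x
  have := (Jet.const k x 64).add ((((j 0).mul (j 0)).add (((j 1).mul (j 1)).add ((j 2).mul (j 2)))).cmul (-1))
  refine Jet.vals this ?_ ?_
  · fin_cases k <;> simp <;> ring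
  · fin_cases k <;> simp

lemma jet_w {u : E3 → ℝ} {x : E3} (hu : ContDiffAt ℝ (⊤ : ℕ∞) u x) (α β : ℝ) (k : Fin 3)
    (l : Fin 3 → ℝ) (hl : ∀ i j, pd i (pd j u) x = if i = j then l i else 0) :
    Jet k (wfun α β u) x ((α * x k + β * pd k u x) * l k)
      (α * l k + β * l k^2 + ((α * x 0 + β * pd 0 u x) * pd k (pd k (pd 0 u)) x
        + (α * x 1 + β * pd 1 u x) * pd k (pd k (pd 1 u)) x
        + (α * x 2 + β * pd 2 u x) * pd k (pd k (pd 2 u)) x)) := by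
  have j : ∀ l, Jet k (fun y : E3 => y l) x _ _ := fun l => Jet.coord k l x
  have p : ∀ i, Jet k (pd i u) x _ _ := fun i => Jet.of k (top2 (pd_smooth i hu))
  have v : Jet k u x _ _ := Jet.of k (top2 hu)
  have := (((((j 0).mul (p 0)).add (((j 1).mul (p 1)).add ((j 2).mul (p 2)))).add (v.cmul (-1))).cmul α).add
    ((((p 0).mul (p 0)).add (((p 1).mul (p 1)).add ((p 2).mul (p 2)))).cmul (β/2))
  refine Jet.vals this ?_ ?_
  · simp only [hl]
    fin_cases k <;> simp <;> ring
  · simp only [hl]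
    fin_cases k <;> simp <;> ring

lemma jet_sigma2 {u : E3 → ℝ} {x : E3} (hu : ∀ᶠ y in nhds x, ContDiffAt ℝ (⊤ : ℕ∞) u y) (k : Fin 3)
    (l : Fin 3 → ℝ) (hl : ∀ i j, pd i (pd j u) x = if i = j then l i else 0) :
    Jet k (fun y => sigma2 (hess u y)) x
      ((l 1 + l 2) * pd k (pd 0 (pd 0 u)) x + (l 0 + l 2) * pd k (pd 1 (pd 1 u)) x
        + (l 0 + l 1) * pd k (pd 2 (pd 2 u)) x)
      ((l 1 + l 2) * pd k (pd k (pd 0 (pd 0 u))) x + (l 0 + l 2) * pd k (pd k (pd 1 (pd 1 u))) x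
        + (l 0 + l 1) * pd k (pd k (pd 2 (pd 2 u))) x
        + 2 * (pd k (pd 0 (pd 0 u)) x * pd k (pd 1 (pd 1 u)) x
          + pd k (pd 0 (pd 0 u)) x * pd k (pd 2 (pd 2 u)) x
          + pd k (pd 1 (pd 1 u)) x * pd k (pd 2 (pd 2 u)) x
          - pd k (pd 0 (pd 1 u)) x ^ 2 - pd k (pd 0 (pd 2 u)) x ^ 2
          - pd k (pd 1 (pd 2 u)) x ^ 2)) := by
  have e : (fun y => sigma2 (hess u y)) = _ := funext (sigma2_eq u)
  rw [e]
  have j : ∀ i j, Jet k (pd i (pd j u)) x _ _ := fun i j =>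
    Jet.of k (top2 (pd_smooth i (pd_smooth j hu.self_of_nhds)))
  have := ((j 0 0).mul (j 1 1)).add (((j 0 0).mul (j 2 2)).add (((j 1 1).mul (j 2 2)).add
    ((((j 0 1).mul (j 1 0)).add (((j 0 2).mul (j 2 0)).add ((j 1 2).mul (j 2 1)))).cmul (-1))))
  refine Jet.vals this ?_ ?_
  · simp only [hl]
    simp
    ring
  · rw [T_symm2 hu k 1 0, T_symm2 hu k 2 0, T_symm2 hu k 2 1]
    simp only [hl]
    simp
    ring
/-! ### The estimate at a maximum point with diagonal Hessian -/

lemma norm_coord_le (y : E3) (k : Fin 3) : |y k| ≤ ‖y‖ := by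
  have := PiLp.norm_apply_le y k
  simpa using this

lemma norm_sq3 (y : E3) : ‖y‖^2 = y 0^2 + y 1^2 + y 2^2 := by
  rw [EuclideanSpace.norm_sq_eq]; simp [Fin.sum_univ_three]

lemma rhofun_eq (y : E3) : rhofun y = 64 - ‖y‖^2 := by
  rw [norm_sq3]; unfold rhofun; ring

lemma Hyp.smooth {K : ℝ} {f : E3 × ℝ × E3 → ℝ} {u : E3 → ℝ} (H : Hyp K f u) {x : E3}
    (hx : x ∈ ball (0 : E3) 10) : ∀ᶠ y in nhds x, ContDiffAt ℝ (⊤ : ℕ∞) u y := by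
  filter_upwards [isOpen_ball.mem_nhds hx] with y hy
  exact H.2.2.2.1.contDiffAt (isOpen_ball.mem_nhds hy)

set_option maxHeartbeats 1000000 in
lemma point_est (K β κ N M : ℝ) (f : E3 × ℝ × E3 → ℝ) (u : E3 → ℝ) (x : E3) (l : Fin 3 → ℝ)
    (hK : 1 ≤ K) (H : Hyp K f u) (hκ : κ = 64*(2300*K^7)) (hβ : β * (2178*κ*K^2) = 1)
    (hN1 : 24*4096*κ ≤ N) (hN2 : 64*384*(2300*K^7) < N * (β^2*K)) (hN3 : 8192 ≤ N * β)
    (hM : 1/K ≤ M) (hx8 : ‖x‖ < 8) (hx1 : 1 ≤ ‖x‖)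
    (hl : ∀ i j, pd i (pd j u) x = if i = j then l i else 0)
    (hb : 0 < Real.log (lap u x) + (- Real.log M))
    (hmax : IsLocalMax (fun y => 2 * Real.log (rhofun y) + (wfun (4*K*β) β u y
      + Real.log (Real.log (lap u y) + (- Real.log M)))) x) :
    (Real.log (lap u x) + (- Real.log M)) * rhofun x ^2 ≤ N := by
  by_contra hcon
  push Not at hcon
  have hK0 : 0 < K := by linarith
  have hx10 : x ∈ ball (0 : E3) 10 := by rw [mem_ball_zero_iff]; linarith
  have hu := H.smooth hx10
  obtain ⟨hf, hfK, hfd, -, heq, hlap, hbd⟩ := H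
  have hux := hu.self_of_nhds
  set b := Real.log (lap u x) + (- Real.log M) with hbdef
  set σ := lap u x with hσdef
  set ρ := rhofun x with hρdef
  have hρ0 : 0 < ρ := by rw [hρdef, rhofun_eq]; nlinarith
  have hρ64 : ρ ≤ 64 := by rw [hρdef, rhofun_eq]; nlinarith
  have hσ0 : 0 < σ := hlap x hx10
  have hσ : σ = l 0 + l 1 + l 2 := by
    rw [hσdef, lap_eq, hl, hl, hl]; simp; ring
  have hs2 : sigma2 (hess u x) = l 0 * l 1 + l 0 * l 2 + l 1 * l 2 := by
    rw [sigma2_eq]; simp only [hl]; simp; ring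
  have hf2 : 1/K ≤ l 0 * l 1 + l 0 * l 2 + l 1 * l 2 := by
    rw [← hs2, heq x hx10]; exact hfK _
  have L0 := lam_bds K (l 0) (l 1) (l 2) hK (by linarith) (by linarith)
  have L1 := lam_bds K (l 1) (l 0) (l 2) hK (by linarith) (by linarith)
  have L2 := lam_bds K (l 2) (l 0) (l 1) hK (by linarith) (by linarith)
  rw [← hσ] at L0
  rw [show l 1 + l 0 + l 2 = σ by rw [hσ]; ring] at L1
  rw [show l 2 + l 0 + l 1 = σ by rw [hσ]; ring] at L2
  have hlσ : ∀ k, |l k| ≤ σ := by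
    intro k; fin_cases k
    exacts [L0.1, L1.1, L2.1]
  have hKσ : 1 ≤ K * σ := L0.2.2.2
  have hp : ∀ k, |pd k u x| ≤ K := by
    intro k
    have h1 := norm_coord_le (grad u x) k
    have h2 : grad u x k = pd k u x := rfl
    rw [h2] at h1
    have := hbd x hx10
    have := abs_nonneg (u x)
    linarith
  have hxk : ∀ k, |x k| ≤ 8 := fun k => (norm_coord_le x k).trans hx8.le
  obtain ⟨A, B, hA, hB, hAB, hD⟩ := phi_bounds K σ f u hf hK hfd hu l hl hlσ hσ.symm hKσ hp
  have hφe : (fun y => f (y, u y, grad u y)) =ᶠ[nhds x] fun y => sigma2 (hess u y) := by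
    filter_upwards [isOpen_ball.mem_nhds hx10] with y hy using (heq y hy).symm
  have Jφ := fun k => (jet_sigma2 hu k l hl).congr hφe
  have JL := fun k => jet_lap hux k
  have JM := fun k => (((jet_rho x k).log hρ0.ne').cmul 2).add ((jet_w hux (4*K*β) β k l hl).add
    ((((JL k).log hσ0.ne').add (Jet.const k x (- Real.log M))).log hb.ne'))
  have C := fun k => (JM k).max hmax
  let T : Fin 3 → Fin 3 → Fin 3 → ℝ := fun i j k => pd i (pd j (pd k u)) x
  have hT1 : ∀ i j k, T i j k = T j i k := T_symm1 hu
  have hT2 : ∀ i j k, T i j k = T i k j := T_symm2 hu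
  have hTc : ∀ i k, T k i i = T i i k := fun i k => by rw [hT1 k i i, hT2 i k i]
  let t : Fin 3 → ℝ := fun k => T 0 0 k + T 1 1 k + T 2 2 k
  let S : Fin 3 → ℝ := fun k => pd k (pd k (pd 0 (pd 0 u))) x + (pd k (pd k (pd 1 (pd 1 u))) x
        + pd k (pd k (pd 2 (pd 2 u))) x)
  have ht' : ∀ k, pd k (pd 0 (pd 0 u)) x + (pd k (pd 1 (pd 1 u)) x + pd k (pd 2 (pd 2 u)) x) = t k := by
    intro k
    change T k 0 0 + (T k 1 1 + T k 2 2) = _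
    rw [hTc 0 k, hTc 1 k, hTc 2 k]
    simp only [t]; ring
  have hκ1 : 1 ≤ κ := by
    have : 1 ≤ K^7 := one_le_pow₀ hK
    rw [hκ]; linarith
  have hβ0 : 0 < β := by
    by_contra h
    push Not at h
    have : β * (2178*κ*K^2) ≤ 0 := mul_nonpos_of_nonpos_of_nonneg h (by positivity)
    linarith
  have hβK : β * (33 * K) ≤ 1 := by
    rw [← hβ]
    apply mul_le_mul_of_nonneg_left _ hβ0.le
    nlinarith
  have hbσ : b ≤ K * σ := by
    have h1 : - Real.log M ≤ Real.log K := by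
      have := Real.log_le_log (by positivity) hM
      rw [Real.log_div one_ne_zero hK0.ne', Real.log_one] at this
      linarith
    have h2 := Real.log_le_sub_one_of_pos (mul_pos hK0 hσ0)
    rw [Real.log_mul hK0.ne' hσ0.ne'] at h2
    linarith
  have h1st : ∀ k, -4 * x k / ρ + (4*K*β * x k + β * pd k u x) * l k + t k / σ / b = 0 := by
    intro k
    have := (C k).1
    rw [ht' k] at this
    rw [← this]
    simp only [add_zero]
    change _ = 2 * (-2 * x k / ρ) + (_ + t k / σ / b)
    ring
  have h2nd : ∀ k, -4/ρ - 8 * x k^2/ρ^2 + (4*K*β * l k + β * l k^2 +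
      ((4*K*β * x 0 + β * pd 0 u x) * T 0 k k + (4*K*β * x 1 + β * pd 1 u x) * T 1 k k
        + (4*K*β * x 2 + β * pd 2 u x) * T 2 k k)) +
      (S k / σ - t k^2/σ^2) / b - (t k / σ)^2/b^2 ≤ 0 := by
    intro k
    refine le_trans (le_of_eq ?_) (C k).2
    rw [ht' k]
    simp only [add_zero]
    rw [hTc k 0, hTc k 1, hTc k 2]
    change _ = 2 * (-2 / ρ - (-2 * x k)^2 / ρ^2) + ((4*K*β * l k + β * l k^2 +
      ((4*K*β * x 0 + β * pd 0 u x) * T k k 0 + (4*K*β * x 1 + β * pd 1 u x) * T k k 1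
        + (4*K*β * x 2 + β * pd 2 u x) * T k k 2)) + ((S k / σ - t k^2/σ^2) / b - (t k / σ)^2/b^2))
    ring
  have hmain := alg_core K (4*K*β) β ρ b σ (l 0 * l 1 + l 0 * l 2 + l 1 * l 2)
    (∑ k, pd k (pd k (fun y => f (y, u y, grad u y))) x) l t x (fun k => pd k u x) A B S
    (fun k => pd k (fun y => f (y, u y, grad u y)) x) T hK hρ0 hb (by positivity) hσ hσ0 rfl hf2
    hT1 hT2 (fun k => rfl) ?_ hAB hA hB hxk ?_ ?_ ?_ h1st h2nd
  · refine alg_contra K β κ N ρ b σ l t x (fun k => pd k u x) hK hρ0 hρ64 hκ hβ hN1 hN2 hN3 hcon hbσ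
      hσ hσ0 hf2 hxk hp ?_ h1st hmain
    rw [← norm_sq3]; exact one_le_pow₀ hx1
  · intro k
    change _ = pd k (fun y => f (y, u y, grad u y)) x
    rw [(Jφ k).d1]
    change _ = (l 1 + l 2) * T k 0 0 + (l 0 + l 2) * T k 1 1 + (l 0 + l 1) * T k 2 2
    rw [hTc 0 k, hTc 1 k, hTc 2 k, hσ]
    ring
  · intro k
    have e1 : |4*K*β * x k| ≤ 32 * K * β := by
      rw [abs_mul, abs_of_pos (by positivity : 0 < 4*K*β)]
      have := mul_le_mul_of_nonneg_left (hxk k) (by positivity : 0 ≤ 4*K*β)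
      linarith
    have e2 : |β * pd k u x| ≤ β * K := by
      rw [abs_mul, abs_of_pos hβ0]
      exact mul_le_mul_of_nonneg_left (hp k) hβ0.le
    have := abs_add_le (4*K*β * x k) (β * pd k u x)
    linarith
  · rw [Fin.sum_univ_three (f := fun k => pd k (pd k (fun y => f (y, u y, grad u y))) x), (Jφ 0).d2, (Jφ 1).d2, (Jφ 2).d2]
    simp only [S, t]
    rw [Q_symm hu 0 1, Q_symm hu 0 2, Q_symm hu 1 2]
    simp only [Fin.sum_univ_three]
    simp only [← show ∀ i j k, T i j k = pd i (pd j (pd k u)) x from fun _ _ _ => rfl]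
    have s1 := hT1 1 0 0
    have s2 := hT1 2 0 0
    have s3 := hT1 1 0 1
    have s4 := hT1 2 0 2
    have s5 := hT1 2 1 1
    have s6 := hT1 2 1 2
    have s7 := hT1 1 0 2
    have s8 := hT1 2 0 1
    have s9 := hT1 2 1 0
    have r1 := hT2 0 1 0
    have r2 := hT2 0 2 0
    have r3 := hT2 0 2 1
    have r4 := hT2 1 1 0
    have r5 := hT2 1 2 0
    have r6 := hT2 1 2 1
    have r7 := hT2 2 1 0
    have r8 := hT2 2 2 0
    have r9 := hT2 2 2 1
    have a1 : T 0 1 0 = T 0 0 1 := r1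
    have a2 : T 1 0 0 = T 0 0 1 := s1.trans r1
    have a3 : T 0 2 0 = T 0 0 2 := r2
    have a4 : T 2 0 0 = T 0 0 2 := s2.trans r2
    have a5 : T 1 0 1 = T 0 1 1 := s3
    have a6 : T 1 1 0 = T 0 1 1 := r4.trans s3
    have a7 : T 2 0 2 = T 0 2 2 := s4
    have a8 : T 2 2 0 = T 0 2 2 := r8.trans s4
    have a9 : T 1 2 1 = T 1 1 2 := r6
    have a10 : T 2 1 1 = T 1 1 2 := s5.trans r6
    have a11 : T 2 1 2 = T 1 2 2 := s6
    have a12 : T 2 2 1 = T 1 2 2 := r9.trans s6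
    have a13 : T 0 2 1 = T 0 1 2 := r3
    have a14 : T 1 0 2 = T 0 1 2 := s7
    have a15 : T 1 2 0 = T 0 1 2 := r5.trans s7
    have a16 : T 2 0 1 = T 0 1 2 := s8.trans r3
    have a17 : T 2 1 0 = T 0 1 2 := r7.trans a16
    rw [a1, a2, a3, a4, a5, a6, a7, a8, a9, a10, a11, a12, a13, a14, a15, a16, a17, hσ]
    ring
  · refine le_trans (le_of_eq ?_) hD
    simp only [Fin.sum_univ_three]
    rfl
/-! ### Rotation invariance -/

section rot
variable (R : E3 ≃ₗᵢ[ℝ] E3)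

lemma R_ext (g : E3) (m : Fin 3) : (R g) m = ∑ i, g i * (R (ee i)) m := by
  have : g = ∑ i, g i • ee i := by
    ext j
    fin_cases j <;> simp [Fin.sum_univ_three]
  conv_lhs => rw [this]
  simp [Fin.sum_univ_three]

def Qm : Matrix (Fin 3) (Fin 3) ℝ := Matrix.of fun i m => (R (ee i)) m

lemma Qm_mul : Qm R * (Qm R).transpose = 1 := by
  ext i j
  have h : inner ℝ (R (ee j)) (R (ee i)) = inner ℝ (ee j) (ee i) := R.inner_map_map _ _
  rw [PiLp.inner_apply] at h
  simp only [Matrix.mul_apply, Matrix.transpose_apply, Qm, Matrix.of_apply]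
  simp only [RCLike.inner_apply, conj_trivial] at h
  rw [h]
  simp [Matrix.one_apply, EuclideanSpace.inner_single_left, eq_comm]

lemma Qm_mul' : (Qm R).transpose * Qm R = 1 := mul_eq_one_comm.mp (Qm_mul R)

lemma fderiv_sum_coord (D : E3 →L[ℝ] ℝ) (w : E3) : D w = ∑ m, w m * D (ee m) := by
  have : w = ∑ i, w i • ee i := by
    ext j
    fin_cases j <;> simp [Fin.sum_univ_three]
  conv_lhs => rw [this]
  simp [Fin.sum_univ_three]

lemma pd_rot (h : E3 → ℝ) (i : Fin 3) :
    pd i (fun z => h (R z)) = fun y => ∑ m, Qm R i m * pd m h (R y) := by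
  funext y
  have := R.toContinuousLinearEquiv.comp_right_fderiv (f := h) (x := y)
  have e : (h ∘ R.toContinuousLinearEquiv) = fun z => h (R z) := rfl
  rw [e] at this
  rw [pd, this, ContinuousLinearMap.comp_apply]
  exact fderiv_sum_coord _ _

lemma hess_rot (h : E3 → ℝ) (y : E3) (hh : ContDiffAt ℝ 2 h (R y)) :
    hess (fun z => h (R z)) y = Qm R * hess h (R y) * (Qm R).transpose := by
  ext i j
  have hd : ∀ n, DifferentiableAt ℝ (fun y => pd n h (R y)) y := fun n =>
    DifferentiableAt.comp y (pd_diff n hh) R.toContinuousLinearEquiv.differentiableAt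
  have hd' : ∀ n, DifferentiableAt ℝ (fun y => Qm R j n * pd n h (R y)) y := fun n =>
    (hd n).const_mul _
  have e : ∀ n, pd i (fun y => Qm R j n * pd n h (R y)) y
      = Qm R j n * ∑ m, Qm R i m * pd m (pd n h) (R y) := by
    intro n
    rw [pd_mul i (differentiableAt_const _) (hd n), pd_const, pd_rot R (pd n h) i]
    ring
  simp only [hess, Matrix.of_apply, Matrix.mul_apply, Matrix.transpose_apply]
  rw [pd_rot R h j]
  simp only [Fin.sum_univ_three]
  rw [pd_add i ((hd' 0).fun_add (hd' 1)) (hd' 2), pd_add i (hd' 0) (hd' 1), e, e, e]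
  simp only [Fin.sum_univ_three]
  ring

lemma lap_trace (h : E3 → ℝ) (y : E3) : lap h y = (hess h y).trace := rfl

lemma lap_rot (h : E3 → ℝ) (y : E3) (hh : ContDiffAt ℝ 2 h (R y)) :
    lap (fun z => h (R z)) y = lap h (R y) := by
  rw [lap_trace, lap_trace, hess_rot R h y hh, Matrix.trace_mul_comm, ← Matrix.mul_assoc, Qm_mul',
    Matrix.one_mul]

lemma sigma2_rot (h : E3 → ℝ) (y : E3) (hh : ContDiffAt ℝ 2 h (R y)) :
    sigma2 (hess (fun z => h (R z)) y) = sigma2 (hess h (R y)) := by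
  have h1 : (hess (fun z => h (R z)) y).trace = (hess h (R y)).trace := lap_rot R h y hh
  unfold sigma2
  rw [h1, hess_rot R h y hh]
  set A := hess h (R y)
  have : Qm R * A * (Qm R).transpose * (Qm R * A * (Qm R).transpose)
      = Qm R * (A * A) * (Qm R).transpose := by
    calc _ = Qm R * A * ((Qm R).transpose * Qm R) * A * (Qm R).transpose := by
          simp only [Matrix.mul_assoc]
      _ = _ := by rw [Qm_mul', Matrix.mul_one]; simp only [Matrix.mul_assoc]
  rw [this, Matrix.trace_mul_comm (Qm R * (A * A)), ← Matrix.mul_assoc, Qm_mul', Matrix.one_mul]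

lemma grad_rot (h : E3 → ℝ) (y : E3) : R (grad (fun z => h (R z)) y) = grad h (R y) := by
  ext m
  rw [R_ext]
  have e : ∀ i, grad (fun z => h (R z)) y i = ∑ n, Qm R i n * pd n h (R y) := fun i => by
    change pd i (fun z => h (R z)) y = _
    rw [pd_rot R h i]
  have q : ∀ n, ∑ i, Qm R i m * Qm R i n = if m = n then 1 else 0 := by
    intro n
    have := congrFun (congrFun (Qm_mul' R) m) n
    simpa [Matrix.mul_apply, Matrix.one_apply] using this
  change _ = pd m h (R y)
  simp only [e]
  change ∑ i, (∑ n, Qm R i n * pd n h (R y)) * Qm R i m = _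
  have q0 := q 0
  have q1 := q 1
  have q2 := q 2
  simp only [Fin.sum_univ_three] at *
  calc _ = (Qm R 0 m * Qm R 0 0 + Qm R 1 m * Qm R 1 0 + Qm R 2 m * Qm R 2 0) * pd 0 h (R y)
      + (Qm R 0 m * Qm R 0 1 + Qm R 1 m * Qm R 1 1 + Qm R 2 m * Qm R 2 1) * pd 1 h (R y)
      + (Qm R 0 m * Qm R 0 2 + Qm R 1 m * Qm R 1 2 + Qm R 2 m * Qm R 2 2) * pd 2 h (R y) := by ring
    _ = _ := by
      rw [q0, q1, q2]
      fin_cases m <;> simp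

lemma wfun_eq (α β : ℝ) (u : E3 → ℝ) (y : E3) :
    wfun α β u y = α * (inner ℝ y (grad u y) - u y) + (β/2) * ‖grad u y‖^2 := by
  rw [norm_sq3, PiLp.inner_apply]
  simp only [Fin.sum_univ_three, RCLike.inner_apply, conj_trivial]
  change _ = α * ((pd 0 u y * y 0 + pd 1 u y * y 1 + pd 2 u y * y 2) - u y)
    + (β/2) * (pd 0 u y ^2 + pd 1 u y ^2 + pd 2 u y ^2)
  unfold wfun
  ring

lemma wfun_rot (α β : ℝ) (h : E3 → ℝ) (y : E3) :
    wfun α β (fun z => h (R z)) y = wfun α β h (R y) := by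
  rw [wfun_eq, wfun_eq, ← grad_rot R h y, R.inner_map_map, R.norm_map]

lemma rhofun_rot (y : E3) : rhofun (R y) = rhofun y := by
  rw [rhofun_eq, rhofun_eq, R.norm_map]

def Lrot : (E3 × ℝ × E3) ≃ₗᵢ[ℝ] (E3 × ℝ × E3) where
  toLinearEquiv := R.toLinearEquiv.prodCongr ((LinearEquiv.refl ℝ ℝ).prodCongr R.toLinearEquiv)
  norm_map' := by
    rintro ⟨a, b, c⟩
    simp [Prod.norm_def]

lemma Hyp_rot {K : ℝ} {f : E3 × ℝ × E3 → ℝ} {u : E3 → ℝ} (H : Hyp K f u) :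
    Hyp K (fun z => f (R z.1, z.2.1, R z.2.2)) (fun z => u (R z)) := by
  have hball : ∀ {y}, y ∈ ball (0 : E3) 10 → R y ∈ ball (0 : E3) 10 := by
    intro y hy
    rw [mem_ball_zero_iff] at *
    rwa [R.norm_map]
  have hc2 : ∀ {y}, y ∈ ball (0 : E3) 10 → ContDiffAt ℝ 2 u (R y) := fun hy =>
    top2 (H.smooth (hball hy)).self_of_nhds
  obtain ⟨hf, hfK, hfd, hu, heq, hlap, hbd⟩ := H
  have ef : (fun z : E3 × ℝ × E3 => f (R z.1, z.2.1, R z.2.2)) = f ∘ (Lrot R) := rfl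
  refine ⟨?_, fun z => hfK _, ?_, ?_, ?_, ?_, ?_⟩
  · rw [ef]
    exact hf.comp (Lrot R).toContinuousLinearEquiv.contDiff
  · intro z k hk
    rw [ef, LinearIsometryEquiv.norm_iteratedFDeriv_comp_right]
    exact hfd _ k hk
  · exact hu.comp R.toContinuousLinearEquiv.contDiff.contDiffOn (fun y hy => hball hy)
  · intro y hy
    rw [sigma2_rot R u y (hc2 hy), heq _ (hball hy), ← grad_rot R]
  · intro y hy
    rw [lap_rot R u y (hc2 hy)]
    exact hlap _ (hball hy)
  · intro y hy
    have := hbd _ (hball hy)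
    rwa [← grad_rot R, R.norm_map] at this

end rot

lemma hess_herm {u : E3 → ℝ} {x : E3} (h : ContDiffAt ℝ 2 u x) : (hess u x).IsHermitian := by
  ext i j
  simpa [hess] using pd_comm j i h

lemma exists_rot {u : E3 → ℝ} {x : E3} (h : ContDiffAt ℝ 2 u x) :
    ∃ (R : E3 ≃ₗᵢ[ℝ] E3) (l : Fin 3 → ℝ), ∀ i j,
      (Qm R * hess u x * (Qm R).transpose) i j = if i = j then l i else 0 := by
  have hh := hess_herm h
  refine ⟨hh.eigenvectorBasis.repr.symm, hh.eigenvalues, fun i j => ?_⟩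
  set R := hh.eigenvectorBasis.repr.symm with hR
  have e : ∀ i, R (ee i) = hh.eigenvectorBasis i := fun i => by
    rw [hR]; exact hh.eigenvectorBasis.repr_symm_single i
  have h1 : ∀ m, (hess u x * (Qm R).transpose) m j = hh.eigenvalues j * Qm R j m := by
    intro m
    have := congrFun (hh.mulVec_eigenvectorBasis j) m
    rw [Pi.smul_apply, smul_eq_mul] at this
    simp only [Qm, Matrix.of_apply, e]
    rw [← this]
    simp [Matrix.mul_apply, Matrix.mulVec, dotProduct, Qm, e]
  rw [Matrix.mul_assoc, Matrix.mul_apply]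
  simp only [h1]
  have h2 := congrFun (congrFun (Qm_mul R) i) j
  rw [Matrix.mul_apply, Matrix.one_apply] at h2
  simp only [Matrix.transpose_apply] at h2
  calc _ = hh.eigenvalues j * ∑ m, Qm R i m * Qm R j m := by
        rw [Finset.mul_sum]; exact Finset.sum_congr rfl fun m _ => by ring
    _ = _ := by
      rw [h2]; split_ifs with hij
      · rw [hij, mul_one]
      · rw [mul_zero]

lemma point_est' (K β κ N M : ℝ) (f : E3 × ℝ × E3 → ℝ) (u : E3 → ℝ) (x : E3)
    (hK : 1 ≤ K) (H : Hyp K f u) (hκ : κ = 64*(2300*K^7)) (hβ : β * (2178*κ*K^2) = 1)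
    (hN1 : 24*4096*κ ≤ N) (hN2 : 64*384*(2300*K^7) < N * (β^2*K)) (hN3 : 8192 ≤ N * β)
    (hM : 1/K ≤ M) (hx8 : ‖x‖ < 8) (hx1 : 1 ≤ ‖x‖)
    (hb : 0 < Real.log (lap u x) + (- Real.log M))
    (hmax : IsLocalMax (fun y => 2 * Real.log (rhofun y) + (wfun (4*K*β) β u y
      + Real.log (Real.log (lap u y) + (- Real.log M)))) x) :
    (Real.log (lap u x) + (- Real.log M)) * rhofun x ^2 ≤ N := by
  have hx10 : x ∈ ball (0 : E3) 10 := by rw [mem_ball_zero_iff]; linarith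
  have hu := H.smooth hx10
  obtain ⟨R, l, hRl⟩ := exists_rot (top2 hu.self_of_nhds)
  obtain ⟨y, rfl⟩ := R.surjective x
  have hc := top2 hu.self_of_nhds
  have hev : ∀ᶠ z in nhds y, ContDiffAt ℝ (⊤ : ℕ∞) u (R z) :=
    R.continuous.continuousAt.eventually hu
  have key := point_est K β κ N M _ _ y l hK (Hyp_rot R H) hκ hβ hN1 hN2 hN3 hM
    (by rwa [R.norm_map] at hx8) (by rwa [R.norm_map] at hx1) ?_ ?_ ?_
  · rwa [lap_rot R u y hc, ← rhofun_rot R y] at key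
  · intro i j
    rw [← hRl i j, ← hess_rot R u y hc]
    rfl
  · rw [lap_rot R u y hc]; exact hb
  · have h1 := (R.continuous.continuousAt (x := y)).eventually hmax
    filter_upwards [h1, hev] with z hz hcz
    rw [lap_rot R u y hc, lap_rot R u z (top2 hcz), wfun_rot, wfun_rot, ← rhofun_rot R y,
      ← rhofun_rot R z]
    exact hz
/-! ### The global argument -/

lemma lap_cont {u : E3 → ℝ} {x : E3} (hu : ContDiffAt ℝ (⊤ : ℕ∞) u x) : ContinuousAt (lap u) x :=
  (jet_lap hu 0).cd.continuousAt

lemma wfun_cont {u : E3 → ℝ} {x : E3} (α β : ℝ) (hu : ContDiffAt ℝ (⊤ : ℕ∞) u x) :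
    ContinuousAt (wfun α β u) x := by
  have h0 := hu.continuousAt
  have hp : ∀ k, ContinuousAt (pd k u) x := fun k => (pd_smooth k hu).continuousAt
  have p0 := hp 0
  have p1 := hp 1
  have p2 := hp 2
  unfold wfun
  fun_prop

lemma lap_lower {K : ℝ} (hK : 1 ≤ K) {f : E3 × ℝ × E3 → ℝ} {u : E3 → ℝ} (H : Hyp K f u) {x : E3}
    (hx : x ∈ ball (0 : E3) 10) : 1 / K ≤ lap u x := by
  have hu := (H.smooth hx).self_of_nhds
  obtain ⟨-, hfK, -, -, heq, hlap, -⟩ := H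
  have h1 : 1/K ≤ sigma2 (hess u x) := by rw [heq x hx]; exact hfK _
  have h0 := hlap x hx
  have hK0 : 0 < K := by linarith
  have h2 : 1/K ≤ lap u x ^ 2 := by
    refine h1.trans ?_
    rw [sigma2_eq, lap_eq, pd_comm 1 0 (top2 hu), pd_comm 2 0 (top2 hu), pd_comm 2 1 (top2 hu)]
    nlinarith [sq_nonneg (pd 0 (pd 0 u) x + pd 1 (pd 1 u) x), sq_nonneg (pd 2 (pd 2 u) x),
      sq_nonneg (pd 0 (pd 0 u) x + pd 2 (pd 2 u) x), sq_nonneg (pd 1 (pd 1 u) x + pd 2 (pd 2 u) x),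
      sq_nonneg (pd 0 (pd 1 u) x), sq_nonneg (pd 0 (pd 2 u) x), sq_nonneg (pd 1 (pd 2 u) x),
      sq_nonneg (pd 0 (pd 0 u) x + pd 1 (pd 1 u) x + pd 2 (pd 2 u) x)]
  have h3 : (1/K)^2 ≤ lap u x ^2 := by
    refine le_trans ?_ h2
    have : 1/K ≤ 1 := by rw [div_le_one hK0]; exact hK
    have : 0 < 1/K := by positivity
    nlinarith
  exact le_of_sq_le_sq h3 h0.le

lemma wfun_bound {K β : ℝ} (hβ : 0 ≤ β) (hK : 1 ≤ K) {u : E3 → ℝ} {y : E3} (hy : ‖y‖ ≤ 8)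
    (hb : |u y| + ‖grad u y‖ ≤ K) : |wfun (4*K*β) β u y| ≤ 37*K^2*β := by
  have hg : ‖grad u y‖ ≤ K := by linarith [abs_nonneg (u y)]
  have hu : |u y| ≤ K := by linarith [norm_nonneg (grad u y)]
  have h1 : |inner ℝ y (grad u y)| ≤ 8 * K :=
    (abs_real_inner_le_norm _ _).trans (mul_le_mul hy hg (norm_nonneg _) (by norm_num))
  have h2 : ‖grad u y‖^2 ≤ K^2 := pow_le_pow_left₀ (norm_nonneg _) hg 2
  have h3 : |inner ℝ y (grad u y) - u y| ≤ 9 * K := (abs_sub _ _).trans (by linarith)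
  rw [wfun_eq]
  have h4 : |4*K*β * (inner ℝ y (grad u y) - u y)| ≤ 4*K*β*(9*K) := by
    rw [abs_mul, abs_of_nonneg (by positivity : 0 ≤ 4*K*β)]
    exact mul_le_mul_of_nonneg_left h3 (by positivity)
  have h5 : |β/2 * ‖grad u y‖^2| ≤ β/2 * K^2 := by
    rw [abs_of_nonneg (by positivity)]
    exact mul_le_mul_of_nonneg_left h2 (by positivity)
  have h6 := abs_add_le (4*K*β * (inner ℝ y (grad u y) - u y)) (β/2 * ‖grad u y‖^2)
  have h7 : 0 ≤ β * K^2 := by positivity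
  nlinarith

lemma main_est (K β κ N M : ℝ) (f : E3 × ℝ × E3 → ℝ) (u : E3 → ℝ)
    (hK : 1 ≤ K) (H : Hyp K f u) (hκ : κ = 64*(2300*K^7)) (hβ : β * (2178*κ*K^2) = 1)
    (hβ0 : 0 < β)
    (hN1 : 24*4096*κ ≤ N) (hN2 : 64*384*(2300*K^7) < N * (β^2*K)) (hN3 : 8192 ≤ N * β)
    (hM : 1/K ≤ M) (hM1 : ∀ y ∈ ball (0 : E3) 1, lap u y ≤ M) (x : E3) (hx : x ∈ ball (0 : E3) 5) 
    (hbx : 0 < Real.log (lap u x) + (- Real.log M)) :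
    Real.log (lap u x) + (- Real.log M) ≤ N * Real.exp (2 * (37*K^2*β)) := by
  set W := 37*K^2*β with hW
  have hK0 : 0 < K := by linarith
  have hM0 : 0 < M := lt_of_lt_of_le (by positivity) hM
  have hin : ∀ {y : E3}, ‖y‖ ≤ 8 → y ∈ ball (0 : E3) 10 := by
    intro y hy; rw [mem_ball_zero_iff]; linarith
  let b : E3 → ℝ := fun y => Real.log (lap u y) + (- Real.log M)
  let w : E3 → ℝ := wfun (4*K*β) β u
  let Φ : E3 → ℝ := fun y => rhofun y ^2 * Real.exp (w y) * b y
  have hρc : Continuous rhofun := by unfold rhofun; fun_prop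
  have hbc : ∀ {y : E3}, ‖y‖ ≤ 8 → ContinuousAt b y := by
    intro y hy
    exact ((lap_cont (H.smooth (hin hy)).self_of_nhds).log (H.2.2.2.2.2.1 y (hin hy)).ne').add
      continuousAt_const
  have hwc : ∀ {y : E3}, ‖y‖ ≤ 8 → ContinuousAt w y := by
    intro y hy
    exact wfun_cont _ _ (H.smooth (hin hy)).self_of_nhds
  have hΦc : ContinuousOn Φ (closedBall (0 : E3) 8) := by
    intro y hy
    rw [mem_closedBall_zero_iff] at hy
    exact (((hρc.continuousAt.pow 2).mul (hwc hy).rexp).mul (hbc hy)).continuousWithinAt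
  have hx5 : ‖x‖ < 5 := by rwa [mem_ball_zero_iff] at hx
  obtain ⟨x0, hx0, hmax⟩ := (isCompact_closedBall (0 : E3) 8).exists_isMaxOn
    ⟨0, by simp⟩ hΦc
  rw [mem_closedBall_zero_iff] at hx0
  have hρx : 1 ≤ rhofun x := by rw [rhofun_eq]; nlinarith [norm_nonneg x]
  have hwx : |w x| ≤ W := wfun_bound hβ0.le hK (by linarith) (H.2.2.2.2.2.2 x (hin (by linarith)))
  have hw0 : |w x0| ≤ W := wfun_bound hβ0.le hK hx0 (H.2.2.2.2.2.2 x0 (hin hx0))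
  have hΦx : Φ x ≤ Φ x0 := hmax (by rw [mem_closedBall_zero_iff]; linarith)
  have hΦx' : Real.exp (-W) * b x ≤ Φ x := by
    have h1 : Real.exp (-W) ≤ Real.exp (w x) := Real.exp_le_exp.mpr (abs_le.mp hwx).1
    have h2 : 1 ≤ rhofun x ^2 := one_le_pow₀ hρx
    have h3 : Real.exp (-W) ≤ rhofun x ^2 * Real.exp (w x) := by
      have := Real.exp_pos (w x)
      nlinarith
    exact mul_le_mul_of_nonneg_right h3 hbx.le
  have hpos : 0 < Φ x0 := lt_of_lt_of_le (mul_pos (Real.exp_pos _) hbx) (hΦx'.trans hΦx)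
  have hb0 : 0 < b x0 := by
    by_contra h
    push Not at h
    have : Φ x0 ≤ 0 := mul_nonpos_of_nonneg_of_nonpos (by positivity) h
    linarith
  have hx08 : ‖x0‖ < 8 := by
    rcases hx0.lt_or_eq with h | h
    · exact h
    · exfalso
      have : rhofun x0 = 0 := by rw [rhofun_eq, h]; norm_num
      have : Φ x0 = 0 := by simp only [Φ, this]; ring
      linarith
  have hρ0 : 0 < rhofun x0 := by rw [rhofun_eq]; nlinarith [norm_nonneg x0]
  have hx01 : 1 ≤ ‖x0‖ := by
    by_contra h
    push Not at h
    have h1 := hM1 x0 (by rwa [mem_ball_zero_iff])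
    have h2 := Real.log_le_log (H.2.2.2.2.2.1 x0 (hin hx0)) h1
    simp only [b] at hb0
    linarith
  have hlm : IsLocalMax (fun y => 2 * Real.log (rhofun y) + (wfun (4*K*β) β u y
      + Real.log (Real.log (lap u y) + (- Real.log M)))) x0 := by
    have key : ∀ y, 0 < rhofun y → 0 < b y → Real.log (Φ y) =
        2 * Real.log (rhofun y) + (wfun (4*K*β) β u y
      + Real.log (Real.log (lap u y) + (- Real.log M))) := by
      intro y h1 h2
      simp only [Φ]
      rw [Real.log_mul (by positivity) h2.ne', Real.log_mul (by positivity) (by positivity),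
        Real.log_exp, Real.log_pow]
      push_cast
      simp only [w, b]
      ring
    filter_upwards [hρc.continuousAt.eventually (lt_mem_nhds hρ0),
      (hbc hx0).eventually (lt_mem_nhds hb0),
      isOpen_ball.mem_nhds (show x0 ∈ ball (0 : E3) 8 by rwa [mem_ball_zero_iff])] with y h1 h2 h3
    rw [← key y h1 h2, ← key x0 hρ0 hb0]
    refine Real.log_le_log ?_ (hmax (ball_subset_closedBall h3))
    simp only [Φ]
    positivity
  have hest := point_est' K β κ N M f u x0 hK H hκ hβ hN1 hN2 hN3 hM hx08 hx01 hb0 hlm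
  have hΦ0 : Φ x0 ≤ N * Real.exp W := by
    have h1 : Real.exp (w x0) ≤ Real.exp W := Real.exp_le_exp.mpr (abs_le.mp hw0).2
    have h2 : Φ x0 = (b x0 * rhofun x0 ^2) * Real.exp (w x0) := by simp only [Φ]; ring
    rw [h2]
    have h3 : 0 < b x0 * rhofun x0 ^2 := by positivity
    exact mul_le_mul hest h1 (Real.exp_pos _).le (h3.le.trans hest)
  have hfin := hΦx'.trans (hΦx.trans hΦ0)
  have hE : Real.exp W * Real.exp (-W) = 1 := by rw [← Real.exp_add]; simp
  have := mul_le_mul_of_nonneg_left hfin (Real.exp_pos W).le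
  rw [two_mul, Real.exp_add]
  calc b x = Real.exp W * (Real.exp (-W) * b x) := by rw [← mul_assoc, hE, one_mul]
    _ ≤ _ := this
    _ = _ := by ring

/-- Lemma 4: `sup_{B₅} Δu ≤ C · sup_{B₁} Δu`. -/
theorem stmt_7 :
    ∀ K : ℝ, 1 ≤ K → ∃ C : ℝ, 0 < C ∧
      ∀ (f : E3 × ℝ × E3 → ℝ) (u : E3 → ℝ), Hyp K f u →
        ∀ x ∈ ball (0 : E3) 5, lap u x ≤ C * sSup (lap u '' ball (0 : E3) 1) := by
  intro K hK
  have hK0 : 0 < K := by linarith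
  obtain ⟨κ, hκ⟩ : ∃ κ, κ = 64*(2300*K^7) := ⟨_, rfl⟩
  have hκ0 : 0 < κ := by rw [hκ]; positivity
  obtain ⟨β, hβd⟩ : ∃ β, β = 1/(2178*κ*K^2) := ⟨_, rfl⟩
  have hβ0 : 0 < β := by rw [hβd]; positivity
  have hβ : β * (2178*κ*K^2) = 1 := by rw [hβd]; field_simp
  obtain ⟨N, hN⟩ : ∃ N, N = 24*4096*κ + (64*384*(2300*K^7) + 1)/(β^2*K) + 8192/β := ⟨_, rfl⟩
  have c1 : 0 < 24*4096*κ := by positivity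
  have c2 : 0 < (64*384*(2300*K^7) + 1)/(β^2*K) := by positivity
  have c3 : 0 < 8192/β := by positivity
  have hN0 : 0 < N := by linarith
  have hN2 : 64*384*(2300*K^7) < N * (β^2*K) := by
    have : (64*384*(2300*K^7) + 1)/(β^2*K) ≤ N := by linarith
    rw [div_le_iff₀ (by positivity)] at this
    linarith
  have hN3 : 8192 ≤ N * β := by
    have : 8192/β ≤ N := by linarith
    rwa [div_le_iff₀ hβ0] at this
  have hN1 : 24*4096*κ ≤ N := by linarith
  refine ⟨Real.exp (N * Real.exp (2 * (37*K^2*β))), Real.exp_pos _, ?_⟩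
  intro f u H x hx
  set M := sSup (lap u '' ball (0 : E3) 1) with hMdef
  have hbdd : BddAbove (lap u '' ball (0 : E3) 1) := by
    have hc : ContinuousOn (lap u) (closedBall (0 : E3) 1) := by
      intro y hy
      rw [mem_closedBall_zero_iff] at hy
      exact (lap_cont (H.smooth (by rw [mem_ball_zero_iff]; linarith)).self_of_nhds).continuousWithinAt
    exact ((isCompact_closedBall (0 : E3) 1).bddAbove_image hc).mono
      (Set.image_mono ball_subset_closedBall)
  have hM1 : ∀ y ∈ ball (0 : E3) 1, lap u y ≤ M := fun y hy =>
    le_csSup hbdd (Set.mem_image_of_mem _ hy)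
  have hM : 1/K ≤ M := (lap_lower hK H (by simp)).trans (hM1 0 (by simp))
  have hM0 : 0 < M := lt_of_lt_of_le (by positivity) hM
  have hx10 : x ∈ ball (0 : E3) 10 := ball_subset_ball (by norm_num) hx
  have hl0 : 0 < lap u x := H.2.2.2.2.2.1 x hx10
  have hb : Real.log (lap u x) + (- Real.log M) ≤ N * Real.exp (2 * (37*K^2*β)) := by
    by_cases h : 0 < Real.log (lap u x) + (- Real.log M)
    · exact main_est K β κ N M f u hK H hκ hβ hβ0 hN1 hN2 hN3 hM hM1 x hx h
    · push Not at h
      exact h.trans (by positivity)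
  rw [← Real.log_le_log_iff hl0 (by positivity), Real.log_mul (Real.exp_pos _).ne' hM0.ne',
    Real.log_exp]
  linarith
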